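/- arXiv:1511.08734 — 11 statements merged into one kernel-verified Lean document; each statement's English description precedes it below -/
import Mathlib

section
/- For every prime number v with v ≡ 3 (mod 4), there exist nonnegative integers k1, k2, k3 and a nonnegative integer λ such that v/2 > k1 ≥ k2 ≥ k3 ≥ 0, λ = k1 + k2 + k3 − (3v − 1)/4 (equivalently 4(k1 + k2 + k3) = 4λ + 3v − 1), and λ(v − 1) = k1(k1 − 1) + k2(k2 − 1) + k3(k3 − 1). -/
/-- Rounding to a nearest multiple. -/
lemma exists_round (t x : ℤ) (ht : 0 < t) : ∃ X : ℤ, 4 * (t * X - x) ^ 2 ≤ t ^ 2 := by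
  refine ⟨(2 * x + t) / (2 * t), ?_⟩
  have h1 := Int.mul_ediv_add_emod (2 * x + t) (2 * t)
  have h2 := Int.emod_nonneg (2 * x + t) (b := 2 * t) (by omega)
  have h3 := Int.emod_lt_of_pos (2 * x + t) (b := 2 * t) (by omega)
  set q := (2 * x + t) / (2 * t)
  set r := (2 * x + t) % (2 * t)
  have h4 : 2 * (t * q - x) = t - r := by linarith
  nlinarith

/-- Davenport–Cassels for sums of three squares. -/
lemma davenport_cassels (n : ℤ) : ∀ m : ℕ, ∀ t x y z : ℤ, 0 < t → t.toNat = m →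
    n * t ^ 2 = x ^ 2 + y ^ 2 + z ^ 2 → ∃ a b c : ℤ, n = a ^ 2 + b ^ 2 + c ^ 2 := by
  intro m
  induction m using Nat.strong_induction_on with
  | _ m ih =>
  intro t x y z ht hm h
  obtain ⟨X, hX⟩ := exists_round t x ht
  obtain ⟨Y, hY⟩ := exists_round t y ht
  obtain ⟨Z, hZ⟩ := exists_round t z ht
  obtain ⟨a, ha⟩ : ∃ a, a = X ^ 2 + Y ^ 2 + Z ^ 2 - n := ⟨_, rfl⟩
  obtain ⟨b, hb⟩ : ∃ b, b = 2 * (n * t - (X * x + Y * y + Z * z)) := ⟨_, rfl⟩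
  have key : t * (a * t + b) = (t * X - x) ^ 2 + (t * Y - y) ^ 2 + (t * Z - z) ^ 2 := by
    rw [ha, hb]; linear_combination h
  have key2 : n * (a * t + b) ^ 2 =
      (a * x + b * X) ^ 2 + (a * y + b * Y) ^ 2 + (a * z + b * Z) ^ 2 := by
    have e1 : X ^ 2 + Y ^ 2 + Z ^ 2 = n + a := by rw [ha]; ring
    have e2 : 2 * (X * x + Y * y + Z * z) = 2 * n * t - b := by rw [hb]; ring
    linear_combination a ^ 2 * h - a * b * e2 - b ^ 2 * e1
  by_cases h0 : a * t + b = 0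
  · rw [h0, mul_zero] at key
    have hx : t * X - x = 0 := by
      nlinarith [sq_nonneg (t * X - x), sq_nonneg (t * Y - y), sq_nonneg (t * Z - z)]
    have hy : t * Y - y = 0 := by
      nlinarith [sq_nonneg (t * X - x), sq_nonneg (t * Y - y), sq_nonneg (t * Z - z)]
    have hz : t * Z - z = 0 := by
      nlinarith [sq_nonneg (t * X - x), sq_nonneg (t * Y - y), sq_nonneg (t * Z - z)]
    refine ⟨X, Y, Z, ?_⟩
    have ht2 : t ^ 2 ≠ 0 := by positivity
    apply mul_right_cancel₀ ht2
    rw [h, ← sub_eq_zero.mp hx, ← sub_eq_zero.mp hy, ← sub_eq_zero.mp hz]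
    ring
  · have hnn : 0 ≤ t * (a * t + b) := by rw [key]; positivity
    have hpos : 0 < a * t + b :=
      lt_of_le_of_ne (nonneg_of_mul_nonneg_right hnn ht) (Ne.symm h0)
    have hlt : a * t + b < t := by
      have : t * (a * t + b) < t * t := by
        rw [key]
        have : 0 < t ^ 2 := by positivity
        linarith
      exact lt_of_mul_lt_mul_left this ht.le
    exact ih (a * t + b).toNat (by omega) (a * t + b) _ _ _ hpos rfl key2

/-- Legendre-type pigeonhole argument. -/
lemma exists_rational (n p : ℕ) (α : ℤ) (hn : n % 4 = 3) (hp4 : p % 4 = 1)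
    (hnp : (n : ℤ) ∣ 2 * p + 1) (hα : (2 * p : ℤ) ∣ α ^ 2 - n) :
    ∃ t z w : ℤ, 0 < t ∧ (n : ℤ) * t ^ 2 = z ^ 2 + 2 * p * w ^ 2 := by
  have hn0 : 0 < n := by omega
  have hp0 : 0 < 2 * p := by omega
  have : NeZero n := ⟨hn0.ne'⟩
  have : NeZero (2 * p) := ⟨hp0.ne'⟩
  let A := Nat.sqrt (2 * p * n)
  let B := Nat.sqrt n
  let C := Nat.sqrt (2 * p)
  have hA : A ^ 2 ≤ 2 * p * n := Nat.sqrt_le' _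
  have hB : B ^ 2 ≤ n := Nat.sqrt_le' _
  have hC : C ^ 2 ≤ 2 * p := Nat.sqrt_le' _
  have hA' : 2 * p * n < (A + 1) ^ 2 := Nat.lt_succ_sqrt' _
  have hB' : n < (B + 1) ^ 2 := Nat.lt_succ_sqrt' _
  have hC' : 2 * p < (C + 1) ^ 2 := Nat.lt_succ_sqrt' _
  let S : Finset (ℕ × ℕ × ℕ) :=
    Finset.range (A + 1) ×ˢ (Finset.range (B + 1) ×ˢ Finset.range (C + 1))
  let f : ℕ × ℕ × ℕ → ZMod n × ZMod (2 * p) := fun u =>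
    ((u.1 : ZMod n) - (u.2.1 : ZMod n), (u.1 : ZMod (2 * p)) - (α : ZMod (2 * p)) * u.2.2)
  have hcard : (Finset.univ : Finset (ZMod n × ZMod (2 * p))).card < S.card := by
    simp only [S, Finset.card_product, Finset.card_range, Finset.card_univ, Fintype.card_prod,
      ZMod.card]
    apply lt_of_pow_lt_pow_left₀ 2 (Nat.zero_le _)
    calc (n * (2 * p)) ^ 2 = (2 * p * n) * (n * (2 * p)) := by ring
      _ < (A + 1) ^ 2 * ((B + 1) ^ 2 * (C + 1) ^ 2) := by gcongr
      _ = _ := by ring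
  obtain ⟨u, hu, u', hu', hne, hf⟩ := Finset.exists_ne_map_eq_of_card_lt_of_maps_to
    (f := f) hcard (fun _ _ => Finset.mem_coe.2 (Finset.mem_univ _))
  obtain ⟨z1, w1, t1⟩ := u
  obtain ⟨z2, w2, t2⟩ := u'
  simp only [S, Finset.mem_product, Finset.mem_range] at hu hu'
  simp only [f, Prod.mk.injEq] at hf
  obtain ⟨hf1, hf2⟩ := hf
  obtain ⟨z, hz⟩ : ∃ z : ℤ, z = z1 - z2 := ⟨_, rfl⟩
  obtain ⟨w, hw⟩ : ∃ w : ℤ, w = w1 - w2 := ⟨_, rfl⟩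
  obtain ⟨t, ht⟩ : ∃ t : ℤ, t = t1 - t2 := ⟨_, rfl⟩
  have d1 : (n : ℤ) ∣ z - w := by
    rw [← ZMod.intCast_zmod_eq_zero_iff_dvd, hz, hw]
    push_cast
    linear_combination hf1
  have d2 : (2 * p : ℤ) ∣ z - α * t := by
    have : ((2 * p : ℕ) : ℤ) ∣ z - α * t := by
      rw [← ZMod.intCast_zmod_eq_zero_iff_dvd, hz, ht]
      push_cast
      linear_combination hf2
    exact_mod_cast this
  have hne' : ¬ (z = 0 ∧ w = 0 ∧ t = 0) := by
    rintro ⟨h1, h2, h3⟩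
    apply hne
    simp only [Prod.mk.injEq]
    omega
  have bz : z ^ 2 ≤ 2 * p * n := by
    have : z ^ 2 ≤ (A : ℤ) ^ 2 := sq_le_sq' (by omega) (by omega)
    exact this.trans (by exact_mod_cast hA)
  have bw : w ^ 2 ≤ n := by
    have : w ^ 2 ≤ (B : ℤ) ^ 2 := sq_le_sq' (by omega) (by omega)
    exact this.trans (by exact_mod_cast hB)
  have bt : t ^ 2 ≤ 2 * p := by
    have : t ^ 2 ≤ (C : ℤ) ^ 2 := sq_le_sq' (by omega) (by omega)
    exact this.trans (by exact_mod_cast hC)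
  have bw' : w ^ 2 ≠ n := by
    intro h
    have h4 : w ^ 2 % 4 = 3 := by omega
    rcases Int.even_or_odd' w with ⟨k, rfl | rfl⟩ <;> ring_nf at h4 <;> omega
  have bt' : t ^ 2 ≠ 2 * p := by
    intro h
    have h4 : t ^ 2 % 4 = 2 := by omega
    rcases Int.even_or_odd' t with ⟨k, rfl | rfl⟩ <;> ring_nf at h4 <;> omega
  have e1 : (n : ℤ) ∣ z ^ 2 + 2 * p * w ^ 2 - n * t ^ 2 := by
    have : z ^ 2 + 2 * p * w ^ 2 - n * t ^ 2
      = (z - w) * (z + w) + (2 * p + 1) * w ^ 2 - n * t ^ 2 := by ring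
    rw [this]
    exact ((d1.mul_right _).add (hnp.mul_right _)).sub (Dvd.intro _ rfl)
  have e2 : (2 * p : ℤ) ∣ z ^ 2 + 2 * p * w ^ 2 - n * t ^ 2 := by
    have : z ^ 2 + 2 * p * w ^ 2 - n * t ^ 2
      = (z - α * t) * (z + α * t) + (α ^ 2 - n) * t ^ 2 + 2 * p * w ^ 2 := by ring
    rw [this]
    exact ((d2.mul_right _).add (hα.mul_right _)).add (Dvd.intro _ rfl)
  have hcop : IsCoprime (n : ℤ) (2 * p : ℤ) := by
    obtain ⟨c, hc⟩ := hnp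
    exact ⟨c, -1, by linear_combination -hc⟩
  obtain ⟨q, hq⟩ := hcop.mul_dvd e1 e2
  have hnZ : (0 : ℤ) < n := by exact_mod_cast hn0
  have hpZ : (0 : ℤ) < 2 * p := by exact_mod_cast hp0
  have hNP : (0 : ℤ) < n * (2 * p) := mul_pos hnZ hpZ
  have bwl : w ^ 2 < n := lt_of_le_of_ne bw bw'
  have btl : t ^ 2 < 2 * p := lt_of_le_of_ne bt bt'
  have m1 : (2 * p : ℤ) * w ^ 2 < 2 * p * n := mul_lt_mul_of_pos_left bwl hpZ
  have m2 : (n : ℤ) * t ^ 2 < n * (2 * p) := mul_lt_mul_of_pos_left btl hnZ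
  have m3 : 0 ≤ (2 * p : ℤ) * w ^ 2 := by positivity
  have m4 : 0 ≤ (n : ℤ) * t ^ 2 := by positivity
  have q1 : -1 < q := by
    have : (n * (2 * p) : ℤ) * (-1) < n * (2 * p) * q := by linarith [sq_nonneg z]
    exact lt_of_mul_lt_mul_left this hNP.le
  have q2 : q < 2 := by
    have : (n * (2 * p) : ℤ) * q < n * (2 * p) * 2 := by linarith [sq_nonneg z]
    exact lt_of_mul_lt_mul_left this hNP.le
  obtain rfl | rfl : q = 0 ∨ q = 1 := by omega
  · have ht0 : t ≠ 0 := by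
      rintro rfl
      have z0 : z ^ 2 = 0 := by linarith [sq_nonneg z]
      have w0 : (2 * p : ℤ) * w ^ 2 = 0 := by linarith [sq_nonneg z]
      have w0' : w ^ 2 = 0 := by
        rcases mul_eq_zero.mp w0 with h | h
        · omega
        · exact h
      exact hne' ⟨by simpa using z0, by simpa using w0', rfl⟩
    refine ⟨|t|, z, w, abs_pos.mpr ht0, ?_⟩
    rw [sq_abs]
    linarith
  · refine ⟨t ^ 2 + 2 * p, z * t - 2 * p * w, z + w * t, by positivity, ?_⟩
    linear_combination (-(t ^ 2 + 2 * p) : ℤ) * hq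

/-- Every `n ≡ 3 (mod 8)` is a sum of three squares. -/
lemma three_squares (n : ℕ) (hn : n % 8 = 3) :
    ∃ a b c : ℤ, (n : ℤ) = a ^ 2 + b ^ 2 + c ^ 2 := by
  have hcop : Nat.Coprime ((n - 1) / 2) (4 * n) := by
    obtain ⟨k, rfl⟩ : ∃ k, n = 8 * k + 3 := ⟨n / 8, by omega⟩
    have : (8 * k + 3 - 1) / 2 = 4 * k + 1 := by omega
    rw [this]
    apply Nat.Coprime.mul_right
    · have : 4 * k + 1 = 1 + 4 * k := by ring
      rw [this]; simp
    · have : 8 * k + 3 = 1 + (4 * k + 1) * 2 := by ring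
      rw [this]; simp
  have : NeZero (4 * n) := ⟨by omega⟩
  obtain ⟨p, -, hp, hpm⟩ := Nat.forall_exists_prime_gt_and_modEq 0 (by omega) hcop
  have hp4 : p % 4 = 1 := by
    have := hpm.of_mul_right n
    unfold Nat.ModEq at this
    omega
  have hpn : n ∣ 2 * p + 1 := by
    have h1 := (hpm.of_mul_left 4).mul_left 2
    have h2 : 2 * ((n - 1) / 2) + 1 = n := by omega
    have h3 := h1.add_right 1
    rw [h2] at h3
    exact (Nat.modEq_zero_iff_dvd).1 (h3.trans (by simp [Nat.ModEq]))
  have : Fact p.Prime := ⟨hp⟩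
  have hodd : Odd n := Nat.odd_iff.mpr (by omega)
  have hj : jacobiSym n p = 1 := by
    rw [← jacobiSym.quadratic_reciprocity_one_mod_four hp4 hodd]
    have h2 : jacobiSym (-2) n = 1 := by
      rw [jacobiSym.at_neg_two hodd, ZMod.χ₈'_nat_eq_if_mod_eight]
      simp [hn]; omega
    have h4 : jacobiSym (-2 * p) n = 1 := by
      rw [jacobiSym.mod_left' (b := n) (a₂ := 1)]
      · exact jacobiSym.one_left n
      · apply Int.ModEq.symm
        rw [Int.modEq_iff_dvd]
        have : (n : ℤ) ∣ 2 * p + 1 := by exact_mod_cast hpn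
        have h5 := this.neg_right
        have e : (-2 * (p : ℤ)) - 1 = -(2 * p + 1) := by ring
        rw [e]
        exact h5
    rw [jacobiSym.mul_left, h2, one_mul] at h4
    exact h4
  rw [← jacobiSym.legendreSym.to_jacobiSym] at hj
  have hn0 : ((n : ℤ) : ZMod p) ≠ 0 := by
    intro h
    rw [(legendreSym.eq_zero_iff p n).2 h] at hj
    exact zero_ne_one hj
  obtain ⟨r, hr⟩ := (legendreSym.eq_one_iff p hn0).1 hj
  obtain ⟨r0, rfl⟩ := ZMod.intCast_surjective r
  have hd : (p : ℤ) ∣ r0 ^ 2 - n := by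
    rw [← ZMod.intCast_zmod_eq_zero_iff_dvd]
    push_cast at hr ⊢
    rw [hr]; ring
  obtain ⟨α, hα1, hα2⟩ : ∃ α : ℤ, (p : ℤ) ∣ α ^ 2 - n ∧ α % 2 = 1 := by
    rcases Int.emod_two_eq_zero_or_one r0 with h | h
    · refine ⟨r0 + p, ?_, by omega⟩
      have : (r0 + p) ^ 2 - n = (r0 ^ 2 - n) + p * (2 * r0 + p) := by ring
      rw [this]
      exact hd.add (Dvd.intro _ rfl)
    · exact ⟨r0, hd, h⟩
  have hα : (2 * p : ℤ) ∣ α ^ 2 - n := by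
    apply IsCoprime.mul_dvd _ _ hα1
    · obtain ⟨k, hk⟩ : ∃ k, p = 2 * k + 1 := ⟨p / 2, by omega⟩
      exact ⟨-k, 1, by rw [hk]; push_cast; ring⟩
    · obtain ⟨k, rfl⟩ : ∃ k, α = 2 * k + 1 := ⟨α / 2, by omega⟩
      have : (2 * k + 1) ^ 2 = 2 * (2 * k ^ 2 + 2 * k) + 1 := by ring
      rw [this]
      omega
  obtain ⟨t, z, w, ht, h⟩ := exists_rational n p α (by omega) hp4 (by exact_mod_cast hpn) hα
  obtain ⟨a, b, hab⟩ := Nat.Prime.sq_add_sq (p := p) (by omega)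
  have hab' : (a : ℤ) ^ 2 + b ^ 2 = p := by exact_mod_cast hab
  refine davenport_cassels n _ t z ((a + b) * w) ((a - b) * w) ht rfl ?_
  rw [h, ← hab']; ring

/-- The final construction, from sorted odd natural numbers. -/
lemma build (v x y z : ℕ) (hv3 : 3 ≤ v) (hv4 : v % 4 = 3) (hx : x % 2 = 1) (hy : y % 2 = 1)
    (hz : z % 2 = 1) (hxy : x ≤ y) (hyz : y ≤ z) (h : x ^ 2 + y ^ 2 + z ^ 2 + 1 = 4 * v) :
    ∃ k1 k2 k3 lam : ℕ,
      2 * k1 < v ∧ k2 ≤ k1 ∧ k3 ≤ k2 ∧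
      4 * (k1 + k2 + k3) + 1 = 4 * lam + 3 * v ∧
      lam * (v - 1) = k1 * (k1 - 1) + k2 * (k2 - 1) + k3 * (k3 - 1) := by
  have hzv : z ≤ v := by
    by_contra hc
    push Not at hc
    nlinarith
  obtain ⟨k1, h1⟩ : ∃ k, v = x + 2 * k := ⟨(v - x) / 2, by omega⟩
  obtain ⟨k2, h2⟩ : ∃ k, v = y + 2 * k := ⟨(v - y) / 2, by omega⟩
  obtain ⟨k3, h3⟩ : ∃ k, v = z + 2 * k := ⟨(v - z) / 2, by omega⟩
  obtain ⟨l, hl⟩ : ∃ l : ℤ, 4 * ((k1 : ℤ) + k2 + k3) + 1 = 4 * l + 3 * v :=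
    ⟨(4 * ((k1 : ℤ) + k2 + k3) + 1 - 3 * v) / 4, by omega⟩
  have cast : ∀ k : ℕ, ((k * (k - 1) : ℕ) : ℤ) = (k : ℤ) * (k - 1) := by
    intro k
    cases k <;> simp
  have e1 : (x : ℤ) = v - 2 * k1 := by omega
  have e2 : (y : ℤ) = v - 2 * k2 := by omega
  have e3 : (z : ℤ) = v - 2 * k3 := by omega
  have hZ : (x : ℤ) ^ 2 + y ^ 2 + z ^ 2 + 1 = 4 * v := by exact_mod_cast h
  rw [e1, e2, e3] at hZ
  have main : l * ((v : ℤ) - 1) = k1 * ((k1 : ℤ) - 1) + k2 * ((k2 : ℤ) - 1)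
      + k3 * ((k3 : ℤ) - 1) := by
    have : 4 * (l * ((v : ℤ) - 1)) = 4 * (k1 * ((k1 : ℤ) - 1) + k2 * ((k2 : ℤ) - 1)
      + k3 * ((k3 : ℤ) - 1)) := by
      linear_combination (-((v : ℤ) - 1)) * hl - hZ
    linarith
  have hl0 : 0 ≤ l := by
    have : 0 ≤ l * ((v : ℤ) - 1) := by
      rw [main, ← cast, ← cast, ← cast]
      positivity
    exact nonneg_of_mul_nonneg_left this (by omega)
  obtain ⟨lam, rfl⟩ := Int.eq_ofNat_of_zero_le hl0
  refine ⟨k1, k2, k3, lam, by omega, by omega, by omega, by omega, ?_⟩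
  zify
  push_cast [Nat.cast_sub (show 1 ≤ v by omega)]
  have c1 := cast k1
  have c2 := cast k2
  have c3 := cast k3
  push_cast at c1 c2 c3
  rw [c1, c2, c3]
  exact main

/-- For every prime `v ≡ 3 (mod 4)` there exist nonnegative integers `k1 ≥ k2 ≥ k3`
with `2 k1 < v`, `λ = k1 + k2 + k3 - (3v-1)/4` (i.e. `4(k1+k2+k3) + 1 = 4λ + 3v`) and
`λ(v-1) = Σ kᵢ(kᵢ-1)`. -/
theorem exists_parameter_set (v : ℕ) (hv : v.Prime) (hv4 : v % 4 = 3) :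
    ∃ k1 k2 k3 lam : ℕ,
      2 * k1 < v ∧ k2 ≤ k1 ∧ k3 ≤ k2 ∧
      4 * (k1 + k2 + k3) + 1 = 4 * lam + 3 * v ∧
      lam * (v - 1) = k1 * (k1 - 1) + k2 * (k2 - 1) + k3 * (k3 - 1) := by
  obtain ⟨a, b, c, habc⟩ := three_squares (4 * v - 1) (by omega)
  have h : a.natAbs ^ 2 + b.natAbs ^ 2 + c.natAbs ^ 2 + 1 = 4 * v := by
    zify
    simp only [sq_abs]
    omega
  have par : ∀ x : ℕ, (x % 2 = 0 ∧ x ^ 2 % 4 = 0) ∨ (x % 2 = 1 ∧ x ^ 2 % 4 = 1) := by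
    intro x
    rcases Nat.even_or_odd' x with ⟨k, rfl | rfl⟩
    · left; ring_nf; omega
    · right; ring_nf; omega
  generalize a.natAbs = x at h
  generalize b.natAbs = y at h
  generalize c.natAbs = z at h
  have hx : x % 2 = 1 := by have := par x; have := par y; have := par z; omega
  have hy : y % 2 = 1 := by have := par x; have := par y; have := par z; omega
  have hz : z % 2 = 1 := by have := par x; have := par y; have := par z; omega
  have hv3 : 3 ≤ v := by omega
  rcases le_total x y with h1 | h1 <;> rcases le_total y z with h2 | h2 <;>
    rcases le_total x z with h3 | h3
  · exact build v x y z hv3 hv4 hx hy hz h1 h2 (by omega)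
  · exact build v x y z hv3 hv4 hx hy hz h1 h2 (by omega)
  · exact build v x z y hv3 hv4 hx hz hy h3 h2 (by omega)
  · exact build v z x y hv3 hv4 hz hx hy h3 h1 (by omega)
  · exact build v y x z hv3 hv4 hy hx hz h1 h3 (by omega)
  · exact build v y z x hv3 hv4 hy hz hx h2 h3 (by omega)
  · exact build v z y x hv3 hv4 hz hy hx h2 h1 (by omega)
  · exact build v z y x hv3 hv4 hz hy hx h2 h1 (by omega)
end

section
/- Every positive integer m with m ≡ 3 (mod 8) can be written as m = s1² + s2² + s3² where s1, s2, s3 are positive odd integers. -/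
/-- Reduce `f` modulo `a` to a residue of absolute value at most `a / 2`. -/
theorem tos_shift (a f : ℤ) (ha : 0 < a) : ∃ k : ℤ, 2 * (f + k * a) ≤ a ∧ -a ≤ 2 * (f + k * a) := by
  refine ⟨-((2 * f + a) / (2 * a)), ?_, ?_⟩
  · have h1 := Int.emod_add_mul_ediv (2 * f + a) (2 * a)
    have h2 := Int.emod_lt_of_pos (2 * f + a) (by linarith : 0 < 2 * a)
    nlinarith
  · have h1 := Int.emod_add_mul_ediv (2 * f + a) (2 * a)
    have h2 := Int.emod_nonneg (2 * f + a) (by linarith : 2 * a ≠ 0)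
    nlinarith

/-- Reduction of positive definite binary forms. -/
theorem tos_binary (n : ℕ) : ∀ A B C : ℤ, A ≤ n → 0 < A → 0 < A * C - B ^ 2 →
    ∃ p q r s : ℤ, p * s - q * r = 1 ∧ 0 < A * p ^ 2 + 2 * B * p * r + C * r ^ 2 ∧
      3 * (A * p ^ 2 + 2 * B * p * r + C * r ^ 2) ^ 2 ≤ 4 * (A * C - B ^ 2) := by
  induction n with
  | zero => intro A B C h1 h2; exfalso; push_cast at h1; linarith
  | succ n ih =>
    intro A B C hn hA hD
    obtain ⟨t, ht1, ht2⟩ := tos_shift A B hA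
    have hinv : A * (C + 2 * t * B + t ^ 2 * A) - (B + t * A) ^ 2 = A * C - B ^ 2 := by ring
    by_cases hlt : C + 2 * t * B + t ^ 2 * A < A
    · have hpos : 0 < C + 2 * t * B + t ^ 2 * A := by
        by_contra hcon
        nlinarith [sq_nonneg (B + t * A)]
      obtain ⟨p, q, r, s, h1, h2, h3⟩ := ih (C + 2 * t * B + t ^ 2 * A) (-(B + t * A)) A
        (by push_cast at hn; linarith) hpos (by linarith)
      have e : A * (p * t - r) ^ 2 + 2 * B * (p * t - r) * p + C * p ^ 2 =
        (C + 2 * t * B + t ^ 2 * A) * p ^ 2 + 2 * (-(B + t * A)) * p * r + A * r ^ 2 := by ring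
      refine ⟨p * t - r, q * t - s, p, q, by linarith, by rw [e]; exact h2, ?_⟩
      rw [e]; linarith
    · refine ⟨1, 0, 0, 1, by norm_num, by simpa using hA, ?_⟩
      push Not at hlt
      have h5 : 4 * (B + t * A) ^ 2 ≤ A ^ 2 := by nlinarith
      have h6 : A * A ≤ A * (C + 2 * t * B + t ^ 2 * A) := mul_le_mul_of_nonneg_left hlt hA.le
      have e : A * 1 ^ 2 + 2 * B * 1 * 0 + C * 0 ^ 2 = A := by ring
      rw [e]
      linarith

theorem tos_bound (a G : ℤ) (ha : 0 < a) (h7 : 3 * a ^ 2 ≤ 4 * G) (h3 : 3 * G ^ 2 ≤ 4 * a) :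
    a = 1 := by
  by_contra hne
  have ha2 : 2 ≤ a := by omega
  have h9 : (3 * a ^ 2) ^ 2 ≤ (4 * G) ^ 2 := pow_le_pow_left₀ (by positivity) h7 2
  have h10 : 27 * a ^ 4 ≤ 64 * a := by linarith
  have h11 : 8 ≤ a ^ 3 := by
    have := pow_le_pow_left₀ (by norm_num) ha2 3
    linarith
  have h12 : a * 8 ≤ a * a ^ 3 := mul_le_mul_of_nonneg_left h11 ha.le
  have h13 : a * a ^ 3 = a ^ 4 := by ring
  linarith

/-- A positive definite ternary form of determinant one only takes values that are sums of
three squares. -/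
theorem tos_ternary (n : ℕ) : ∀ a b c d e f : ℤ, a ≤ n → 0 < a → 0 < a * b - f ^ 2 →
    a * b * c + 2 * d * e * f - a * d ^ 2 - b * e ^ 2 - c * f ^ 2 = 1 →
    ∀ x y z : ℤ, ∃ u v w : ℤ,
      a * x ^ 2 + b * y ^ 2 + c * z ^ 2 + 2 * d * y * z + 2 * e * x * z + 2 * f * x * y
        = u ^ 2 + v ^ 2 + w ^ 2 := by
  induction n with
  | zero => intro a b c d e f h1 h2; exfalso; push_cast at h1; linarith
  | succ n ih =>
    intro a b c d e f hn ha hab hdet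
    have hD : (a * b - f ^ 2) * (a * c - e ^ 2) - (a * d - e * f) ^ 2 = a := by
      linear_combination a * hdet
    obtain ⟨p, q, r, s, h1, h2, h3⟩ := tos_binary (a * b - f ^ 2).toNat (a * b - f ^ 2)
      (a * d - e * f) (a * c - e ^ 2) (Int.self_le_toNat _) hab (by rw [hD]; exact ha)
    rw [hD] at h3
    obtain ⟨G, hG⟩ : ∃ G, G = (a * b - f ^ 2) * p ^ 2 + 2 * (a * d - e * f) * p * r +
      (a * c - e ^ 2) * r ^ 2 := ⟨_, rfl⟩
    rw [← hG] at h2 h3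
    obtain ⟨b1, hb1⟩ : ∃ t, t = b * p ^ 2 + 2 * d * p * r + c * r ^ 2 := ⟨_, rfl⟩
    obtain ⟨c1, hc1⟩ : ∃ t, t = b * q ^ 2 + 2 * d * q * s + c * s ^ 2 := ⟨_, rfl⟩
    obtain ⟨d1, hd1⟩ : ∃ t, t = b * p * q + d * (p * s + q * r) + c * r * s := ⟨_, rfl⟩
    obtain ⟨e1, he1⟩ : ∃ t, t = f * q + e * s := ⟨_, rfl⟩
    obtain ⟨f1, hf1⟩ : ∃ t, t = f * p + e * r := ⟨_, rfl⟩
    have hG1 : a * b1 - f1 ^ 2 = G := by rw [hG, hb1, hf1]; ring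
    have hdet1 : a * b1 * c1 + 2 * d1 * e1 * f1 - a * d1 ^ 2 - b1 * e1 ^ 2 - c1 * f1 ^ 2 = 1 := by
      have : a * b1 * c1 + 2 * d1 * e1 * f1 - a * d1 ^ 2 - b1 * e1 ^ 2 - c1 * f1 ^ 2 =
        (p * s - q * r) ^ 2 *
          (a * b * c + 2 * d * e * f - a * d ^ 2 - b * e ^ 2 - c * f ^ 2) := by
        rw [hb1, hc1, hd1, he1, hf1]; ring
      rw [this, h1, hdet]; norm_num
    suffices H : ∀ x y z : ℤ, ∃ u v w : ℤ,
        a * x ^ 2 + b1 * y ^ 2 + c1 * z ^ 2 + 2 * d1 * y * z + 2 * e1 * x * z + 2 * f1 * x * y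
        = u ^ 2 + v ^ 2 + w ^ 2 by
      intro x y z
      obtain ⟨u, v, w, h⟩ := H x (s * y - q * z) (p * z - r * y)
      refine ⟨u, v, w, ?_⟩
      have ey : y = p * (s * y - q * z) + q * (p * z - r * y) := by
        linear_combination (-y) * h1
      have ez : z = r * (s * y - q * z) + s * (p * z - r * y) := by
        linear_combination (-z) * h1
      rw [← h]
      generalize s * y - q * z = Y at *
      generalize p * z - r * y = Z at *
      rw [ey, ez, hb1, hc1, hd1, he1, hf1]; ring
    obtain ⟨k, hk1, hk2⟩ := tos_shift a f1 ha
    by_cases hlt : b1 + 2 * k * f1 + k ^ 2 * a < a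
    · have hinv : a * (b1 + 2 * k * f1 + k ^ 2 * a) - (f1 + k * a) ^ 2 = G := by
        rw [← hG1]; ring
      have hpos : 0 < b1 + 2 * k * f1 + k ^ 2 * a := by
        by_contra hcon
        nlinarith [sq_nonneg (f1 + k * a)]
      intro x y z
      obtain ⟨u, v, w, h⟩ := ih (b1 + 2 * k * f1 + k ^ 2 * a) a c1 e1 (d1 + k * e1) (f1 + k * a)
        (by push_cast at hn; linarith) hpos (by linarith)
        (by rw [← hdet1]; ring) y (x - k * y) z
      refine ⟨u, v, w, ?_⟩
      rw [← h]; ring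
    · push Not at hlt
      have h5 : 4 * (f1 + k * a) ^ 2 ≤ a ^ 2 := by nlinarith
      have h6 : a * a ≤ a * (b1 + 2 * k * f1 + k ^ 2 * a) := mul_le_mul_of_nonneg_left hlt ha.le
      have hinv : a * (b1 + 2 * k * f1 + k ^ 2 * a) - (f1 + k * a) ^ 2 = G := by
        rw [← hG1]; ring
      have h7 : 3 * a ^ 2 ≤ 4 * G := by linarith
      have h8 : a = 1 := tos_bound a G ha h7 h3
      subst h8
      have hG2 : G = 1 := by clear * - h2 h3; nlinarith
      rw [hG2] at hG1
      intro x y z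
      refine ⟨x + f1 * y + e1 * z, y + (d1 - e1 * f1) * z, z, ?_⟩
      have hb : b1 = 1 + f1 ^ 2 := by linarith
      subst hb
      linear_combination z ^ 2 * hdet1

theorem tos_exists_form (m : ℕ) (h8 : m % 8 = 3) :
    ∃ u v w : ℤ, (m : ℤ) = u ^ 2 + v ^ 2 + w ^ 2 := by
  obtain ⟨j, rfl⟩ : ∃ j, m = 8 * j + 3 := ⟨m / 8, by omega⟩
  have hcop : Nat.Coprime (4 * j + 1) (4 * (8 * j + 3)) := by
    have e1 : Nat.Coprime (4 * j + 1) 4 := by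
      rw [← Nat.isCoprime_iff_coprime]
      exact ⟨1, -j, by push_cast; ring⟩
    have e2 : Nat.Coprime (4 * j + 1) (8 * j + 3) := by
      rw [← Nat.isCoprime_iff_coprime]
      exact ⟨-2, 1, by push_cast; ring⟩
    exact e1.mul_right e2
  obtain ⟨p, hgt, hp, hmod⟩ := Nat.forall_exists_prime_gt_and_modEq (8 * j + 3)
    (by omega : 4 * (8 * j + 3) ≠ 0) hcop
  have : Fact p.Prime := ⟨hp⟩
  obtain ⟨v, hv⟩ : ∃ v, p = 4 * (8 * j + 3) * v + (4 * j + 1) := by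
    have h := (Nat.modEq_iff_dvd' (by omega : 4 * j + 1 ≤ p)).1 hmod.symm
    obtain ⟨v, hv⟩ := h
    exact ⟨v, by omega⟩
  have hp4 : p % 4 = 1 := by
    rw [hv, mul_assoc]; omega
  have hrel : 2 * p + 1 = (8 * v + 1) * (8 * j + 3) := by rw [hv]; ring
  have hbodd : Odd (8 * v + 1) := ⟨4 * v, by ring⟩
  have hb8 : ((8 * v + 1 : ℕ) : ZMod 8) = 1 := by
    push_cast
    rw [show (8 : ZMod 8) = 0 from rfl]; ring
  have hb4 : (8 * v + 1) % 4 = 1 := by omega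
  have hm1 : jacobiSym (-1) (8 * v + 1) = 1 := by
    rw [jacobiSym.at_neg_one hbodd, ZMod.χ₄_nat_one_mod_four hb4]
  have hm2 : jacobiSym 2 (8 * v + 1) = 1 := by
    rw [jacobiSym.at_two hbodd, hb8]; rfl
  have hm3 : jacobiSym (2 * (p : ℤ)) (8 * v + 1) = 1 := by
    rw [← hm1]
    apply jacobiSym.mod_left'
    apply Int.ModEq.symm
    rw [Int.modEq_iff_dvd]
    refine ⟨8 * j + 3, ?_⟩
    have : (2 * p + 1 : ℤ) = (8 * v + 1) * (8 * j + 3) := by exact_mod_cast hrel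
    push_cast
    linarith
  have hm4 : jacobiSym (p : ℤ) (8 * v + 1) = 1 := by
    rw [jacobiSym.mul_left, hm2, one_mul] at hm3; exact hm3
  have hm5 : jacobiSym (-((8 * v + 1 : ℕ) : ℤ)) p = 1 := by
    rw [neg_eq_neg_one_mul, jacobiSym.mul_left,
      jacobiSym.at_neg_one (Nat.odd_iff.2 (by omega)), ZMod.χ₄_nat_one_mod_four hp4, one_mul,
      jacobiSym.quadratic_reciprocity_one_mod_four hb4 (Nat.odd_iff.2 (by omega))]
    exact hm4
  obtain ⟨g, hg⟩ : ∃ g : ℤ, (p : ℤ) ∣ g ^ 2 + (8 * v + 1) := by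
    obtain ⟨r, hr⟩ := ZMod.isSquare_of_jacobiSym_eq_one hm5
    refine ⟨r.valMinAbs, ?_⟩
    rw [← ZMod.intCast_zmod_eq_zero_iff_dvd]
    push_cast at hr ⊢
    linear_combination -hr
  obtain ⟨g, hg, hodd⟩ : ∃ g : ℤ, (p : ℤ) ∣ g ^ 2 + (8 * v + 1) ∧ g % 2 = 1 := by
    rcases Int.emod_two_eq_zero_or_one g with h | h
    · refine ⟨g + p, ?_, by omega⟩
      have : (g + p) ^ 2 + (8 * v + 1) = (g ^ 2 + (8 * v + 1)) + p * (2 * g + p) := by ring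
      rw [this]
      exact dvd_add hg (dvd_mul_right _ _)
    · exact ⟨g, hg, h⟩
  have h2 : (2 : ℤ) ∣ g ^ 2 + (8 * v + 1) := by
    obtain ⟨i, hi⟩ : ∃ i, g = 2 * i + 1 := ⟨g / 2, by omega⟩
    exact ⟨2 * i ^ 2 + 2 * i + 1 + 4 * v, by rw [hi]; ring⟩
  have hdvd : (2 * p : ℤ) ∣ g ^ 2 + (8 * v + 1) := by
    apply IsCoprime.mul_dvd _ h2 hg
    have : Nat.Coprime 2 p := (Nat.coprime_two_left).2 (Nat.odd_iff.2 (by omega))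
    exact_mod_cast Nat.isCoprime_iff_coprime.2 this
  obtain ⟨a, hadef⟩ := hdvd
  have hrelz : (2 * p + 1 : ℤ) = (8 * v + 1) * (8 * j + 3) := by exact_mod_cast hrel
  have hppos : (0 : ℤ) < p := by exact_mod_cast hp.pos
  have ha : 0 < a := by
    by_contra hcon
    push Not at hcon
    have : 2 * (p : ℤ) * a ≤ 0 := mul_nonpos_of_nonneg_of_nonpos (by linarith) hcon
    nlinarith [sq_nonneg g]
  have hab : a * (2 * p) - g ^ 2 = 8 * v + 1 := by linarith
  obtain ⟨x, y, z, h⟩ := tos_ternary a.toNat a (2 * p) (8 * j + 3) 0 1 g (Int.self_le_toNat _) ha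
    (by rw [hab]; positivity) (by linear_combination (8 * j + 3) * hab - hrelz) 0 0 1
  refine ⟨x, y, z, ?_⟩
  rw [← h]; push_cast; ring

/-- Every positive integer `m ≡ 3 (mod 8)` is a sum of three squares of positive odd
integers. -/
theorem sum_of_three_odd_squares (m : ℕ) (hm : 0 < m) (h8 : m % 8 = 3) :
    ∃ s1 s2 s3 : ℕ, 0 < s1 ∧ 0 < s2 ∧ 0 < s3 ∧
      Odd s1 ∧ Odd s2 ∧ Odd s3 ∧ m = s1 ^ 2 + s2 ^ 2 + s3 ^ 2 := by
  obtain ⟨u, v, w, h⟩ := tos_exists_form m h8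
  have h' : m = u.natAbs ^ 2 + v.natAbs ^ 2 + w.natAbs ^ 2 := by
    zify; simpa using h
  generalize u.natAbs = x at h'
  generalize v.natAbs = y at h'
  generalize w.natAbs = z at h'
  have sq8 : ∀ t : ℕ, (t % 2 = 1 ∧ t ^ 2 % 8 = 1) ∨
      (t % 2 = 0 ∧ (t ^ 2 % 8 = 0 ∨ t ^ 2 % 8 = 4)) := by
    intro t
    have ht : t % 8 < 8 := Nat.mod_lt _ (by norm_num)
    have h2 : t % 2 = t % 8 % 2 := by omega
    rw [Nat.pow_mod, h2]
    generalize t % 8 = r at *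
    interval_cases r <;> simp
  have hx := sq8 x
  have hy := sq8 y
  have hz := sq8 z
  have hall : x % 2 = 1 ∧ y % 2 = 1 ∧ z % 2 = 1 := by omega
  obtain ⟨h1, h2, h3⟩ := hall
  exact ⟨x, y, z, by omega, by omega, by omega, Nat.odd_iff.2 h1, Nat.odd_iff.2 h2,
    Nat.odd_iff.2 h3, h'⟩
end

section
/- Let v be a prime with v ≡ 3 (mod 4) and let Q be the set of nonzero squares (quadratic residues) in Z_v. Then |Q| = (v − 1)/2, Q is of skew type, and Q is a difference set with parameters (v, (v − 1)/2, (v − 3)/4), i.e. for every nonzero c ∈ Z_v there are exactly (v − 3)/4 ordered pairs (a, b) with a, b ∈ Q and a − b ≡ c (mod v). -/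
/-- For a prime `v ≡ 3 (mod 4)`, the Paley–Todd set `Q` of nonzero squares in `ZMod v`
has `(v-1)/2` elements, is of skew type (`0 ∉ Q` and for `i ≠ 0`, `i ∈ Q ↔ -i ∉ Q`),
and is a `(v, (v-1)/2, (v-3)/4)` difference set. -/
theorem paley_todd_difference_set (v : ℕ) [Fact v.Prime] (hv4 : v % 4 = 3) :
    let Q : Finset (ZMod v) :=
      Finset.univ.filter (fun x : ZMod v => ∃ y : ZMod v, y ≠ 0 ∧ y ^ 2 = x)
    Q.card = (v - 1) / 2 ∧
    ((0 : ZMod v) ∉ Q ∧ ∀ i : ZMod v, i ≠ 0 → (i ∈ Q ↔ -i ∉ Q)) ∧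
    ∀ c : ZMod v, c ≠ 0 →
      ((Q ×ˢ Q).filter (fun p => p.1 - p.2 = c)).card = (v - 3) / 4 := by
  intro Q
  have hQ : ∀ x, x ∈ Q ↔ ∃ y : ZMod v, y ≠ 0 ∧ y ^ 2 = x := fun x => by simp [Q]
  have h0 : (0 : ZMod v) ∉ Q := by
    rw [hQ]
    rintro ⟨y, hy, h⟩
    exact hy (pow_eq_zero_iff two_ne_zero |>.1 h)
  have hmul : ∀ c ∈ Q, ∀ x, c * x ∈ Q ↔ x ∈ Q := by
    intro c hc x
    obtain ⟨y, hy, rfl⟩ := (hQ c).1 hc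
    rw [hQ, hQ]
    constructor
    · rintro ⟨z, hz, h⟩
      refine ⟨z / y, div_ne_zero hz hy, ?_⟩
      rw [div_pow, h]
      field_simp
    · rintro ⟨z, hz, rfl⟩
      exact ⟨y * z, mul_ne_zero hy hz, by ring⟩
  have hneg1 : quadraticChar (ZMod v) (-1) = -1 := by
    rw [quadraticChar_neg_one_iff_not_isSquare, FiniteField.isSquare_neg_one_iff, ZMod.card]
    simp [hv4]
  have hchar : ∀ x : ZMod v, x ≠ 0 → (x ∈ Q ↔ quadraticChar (ZMod v) x = 1) := by
    intro x hx
    rw [quadraticChar_one_iff_isSquare hx, hQ]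
    constructor
    · rintro ⟨y, _, rfl⟩
      exact ⟨y, by ring⟩
    · rintro ⟨y, rfl⟩
      exact ⟨y, by rintro rfl; simp at hx, by ring⟩
  have hskew : ∀ i : ZMod v, i ≠ 0 → (i ∈ Q ↔ -i ∉ Q) := by
    intro i hi
    have hm : quadraticChar (ZMod v) (-i) = - quadraticChar (ZMod v) i := by
      rw [← neg_one_mul, map_mul, hneg1, neg_one_mul]
    rw [hchar i hi, hchar (-i) (neg_ne_zero.2 hi), hm]
    rcases quadraticChar_dichotomy hi with h | h <;> simp [h]
  have hcard2 : Q.card + Q.card = v - 1 := by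
    have h1 : (Finset.univ.erase (0 : ZMod v)).card = v - 1 := by
      rw [Finset.card_erase_of_mem (Finset.mem_univ _), Finset.card_univ, ZMod.card]
    have h2 : (Q.image (fun x => -x)).card = Q.card :=
      Finset.card_image_of_injective _ neg_injective
    rw [← h1]
    nth_rewrite 2 [← h2]
    rw [← Finset.card_union_of_disjoint]
    · congr 1
      ext x
      simp only [Finset.mem_union, Finset.mem_image, Finset.mem_erase, Finset.mem_univ, and_true]
      constructor
      · rintro (h | ⟨y, h, rfl⟩)
        · rintro rfl; exact h0 h
        · intro hy; rw [neg_eq_zero] at hy; subst hy; exact h0 h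
      · intro hx
        by_cases h : x ∈ Q
        · exact Or.inl h
        · right
          refine ⟨-x, ?_, neg_neg x⟩
          by_contra h'
          exact h ((hskew x hx).2 h')
    · rw [Finset.disjoint_left]
      intro x hx hx'
      obtain ⟨y, hy, rfl⟩ := Finset.mem_image.1 hx'
      have hy0 : y ≠ 0 := by rintro rfl; exact h0 hy
      exact (hskew y hy0).1 hy hx
  refine ⟨by omega, ⟨h0, hskew⟩, ?_⟩
  set N : ZMod v → ℕ := fun c => ((Q ×ˢ Q).filter (fun p => p.1 - p.2 = c)).card with hN
  have hNQ : ∀ c ∈ Q, N c = N 1 := by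
    intro c hc
    have hc0 : c ≠ 0 := by rintro rfl; exact h0 hc
    symm
    refine Finset.card_bij (fun p _ => (c * p.1, c * p.2)) ?_ ?_ ?_
    · rintro ⟨a, b⟩ h
      simp only [Finset.mem_filter, Finset.mem_product, hmul c hc] at h ⊢
      exact ⟨h.1, by rw [← mul_sub, h.2, mul_one]⟩
    · rintro ⟨a, b⟩ _ ⟨a', b'⟩ _ h
      simpa [hc0] using h
    · rintro ⟨a, b⟩ h
      simp only [Finset.mem_filter, Finset.mem_product] at h
      have ea : c * (c⁻¹ * a) = a := by field_simp
      have eb : c * (c⁻¹ * b) = b := by field_simp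
      refine ⟨(c⁻¹ * a, c⁻¹ * b), ?_, by simp only [ea, eb]⟩
      simp only [Finset.mem_filter, Finset.mem_product]
      rw [← hmul c hc, ← hmul c hc (c⁻¹ * b), ea, eb, ← mul_sub, h.2]
      exact ⟨h.1, inv_mul_cancel₀ hc0⟩
  have hNneg : ∀ c, N (-c) = N c := by
    intro c
    refine Finset.card_bij (fun p _ => (p.2, p.1)) ?_ ?_ ?_
    · rintro ⟨a, b⟩ h
      simp only [Finset.mem_filter, Finset.mem_product] at h ⊢
      exact ⟨h.1.symm, by rw [← neg_sub, h.2, neg_neg]⟩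
    · rintro ⟨a, b⟩ _ ⟨a', b'⟩ _ h
      simp only [Prod.mk.injEq] at h ⊢
      exact h.symm
    · rintro ⟨a, b⟩ h
      simp only [Finset.mem_filter, Finset.mem_product] at h
      refine ⟨(b, a), ?_, rfl⟩
      simp only [Finset.mem_filter, Finset.mem_product]
      exact ⟨h.1.symm, by rw [← neg_sub, h.2]⟩
  have hN1 : ∀ c, c ≠ 0 → N c = N 1 := by
    intro c hc
    by_cases h : c ∈ Q
    · exact hNQ c h
    · rw [← hNneg]
      apply hNQ
      by_contra h'
      exact h ((hskew c hc).2 h')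
  have hN0 : N 0 = Q.card := by
    symm
    refine Finset.card_bij (fun a _ => (a, a)) ?_ ?_ ?_
    · intro a h
      simp [h]
    · intro a _ b _ h
      simpa using h
    · rintro ⟨a, b⟩ h
      simp only [Finset.mem_filter, Finset.mem_product] at h
      exact ⟨a, h.1.1, by rw [sub_eq_zero.1 h.2]⟩
  have hsum : Q.card * Q.card = ∑ c, N c := by
    rw [← Finset.card_product]
    exact Finset.card_eq_sum_card_fiberwise (fun _ _ => Finset.mem_coe.2 (Finset.mem_univ _))
  rw [← Finset.add_sum_erase _ _ (Finset.mem_univ (0 : ZMod v)), hN0,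
    Finset.sum_congr rfl (fun c hc => hN1 c (Finset.ne_of_mem_erase hc)), Finset.sum_const,
    Finset.card_erase_of_mem (Finset.mem_univ _), Finset.card_univ, ZMod.card, ← hcard2,
    smul_eq_mul] at hsum
  intro c hc
  change N c = _
  rw [hN1 c hc]
  have hk : 0 < Q.card := by omega
  have : Q.card = 1 + 2 * N 1 := by
    apply Nat.eq_of_mul_eq_mul_left hk
    rw [hsum]; ring
  omega
end

section
/- Let v be an odd positive integer and let (X0, X1, X2, X3) be a supplementary difference set in Z_v with parameters (v; k0, k1, k2, k3; λ0) such that k0 + k1 + k2 + k3 − λ0 = v and X0 is of skew type. Then there exists a skew-Hadamard matrix of order 4v, i.e. a 4v × 4v matrix H with all entries ±1 such that H·Hᵀ = 4v·I and H + Hᵀ = 2·I. -/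
/-- Supplementary difference set predicate (see paper's Definition 1). -/
def IsSDS (v t : ℕ) (X : Fin t → Finset (ZMod v)) (k : Fin t → ℕ) (lam : ℤ) : Prop :=
  (∀ i, (X i).card = k i) ∧
  ∀ c : ZMod v, c ≠ 0 →
    ((∑ i, (((X i) ×ˢ (X i)).filter (fun p => p.1 - p.2 = c)).card : ℕ) : ℤ) = lam

/-- `X ⊆ ZMod v` is of skew type: `0 ∉ X` and for each nonzero `i`, `i ∈ X ↔ -i ∉ X`. -/
def IsSkewType (v : ℕ) (X : Finset (ZMod v)) : Prop :=
  (0 : ZMod v) ∉ X ∧ ∀ i : ZMod v, i ≠ 0 → (i ∈ X ↔ -i ∉ X)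


namespace GSProof

variable {v : ℕ} [NeZero v]

/-- Back-circulant matrix. -/
def S (f : ZMod v → ℤ) : Matrix (ZMod v) (ZMod v) ℤ := Matrix.of fun x y => f (x + y)

/-- Circulant matrix. -/
def T (f : ZMod v → ℤ) : Matrix (ZMod v) (ZMod v) ℤ := Matrix.of fun x y => f (y - x)

/-- Periodic correlation. -/
def K (f g : ZMod v → ℤ) (s : ZMod v) : ℤ := ∑ y, f y * g (y + s)

/-- Reversal. -/
def rev (f : ZMod v → ℤ) : ZMod v → ℤ := fun x => f (-x)

lemma S_transpose (f : ZMod v → ℤ) : (S f).transpose = S f := by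
  ext x y
  simp [S, add_comm]

lemma K_rev (f g : ZMod v → ℤ) : K (rev f) (rev g) = K g f := by
  ext s
  unfold K rev
  refine Fintype.sum_equiv ((Equiv.addRight s).trans (Equiv.neg _)) _ _ fun y => ?_
  simp only [Equiv.trans_apply, Equiv.coe_addRight, Equiv.neg_apply]
  rw [mul_comm]
  congr 2
  ring

lemma K_rev_left (f g : ZMod v → ℤ) : K f (rev g) = K g (rev f) := by
  rw [← K_rev]
  congr 1
  ext x
  simp [rev]

lemma S_mul_S (f g : ZMod v → ℤ) : S f * S g = T (K f g) := by
  ext x z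
  simp only [S, T, K, Matrix.mul_apply, Matrix.of_apply]
  refine Fintype.sum_equiv (Equiv.addLeft x) _ _ fun y => ?_
  simp only [Equiv.coe_addLeft]
  congr 2
  ring

lemma T_mul_S (a g : ZMod v → ℤ) : T a * S g = S (K a g) := by
  ext x z
  simp only [S, T, K, Matrix.mul_apply, Matrix.of_apply]
  refine Fintype.sum_equiv (Equiv.subRight x) _ _ fun y => ?_
  simp only [Equiv.subRight_apply]
  congr 2
  ring

lemma S_mul_Tt (a g : ZMod v → ℤ) : S g * (T a).transpose = S (K a g) := by
  ext x z
  simp only [S, T, K, Matrix.mul_apply, Matrix.of_apply, Matrix.transpose_apply]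
  refine Fintype.sum_equiv (Equiv.subRight z) _ _ fun y => ?_
  simp only [Equiv.subRight_apply]
  rw [mul_comm]
  congr 2
  ring

lemma T_mul_Tt (a : ZMod v → ℤ) : T a * (T a).transpose = T (K a a) := by
  ext x z
  simp only [T, K, Matrix.mul_apply, Matrix.of_apply, Matrix.transpose_apply]
  refine Fintype.sum_equiv (Equiv.subRight z) _ _ fun y => ?_
  simp only [Equiv.subRight_apply]
  rw [mul_comm]
  congr 2
  ring

/-- Blocks of the Goethals-Seidel array. -/
def blk (a b c d : ZMod v → ℤ) : Fin 4 → Fin 4 → Matrix (ZMod v) (ZMod v) ℤ :=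
  ![![T a, S b, S c, S d],
    ![-S b, T a, S (rev d), -S (rev c)],
    ![-S c, -S (rev d), T a, S (rev b)],
    ![-S d, S (rev c), -S (rev b), T a]]

lemma blk_gram (a b c d : ZMod v → ℤ) (p q : Fin 4) :
    ∑ r, blk a b c d p r * (blk a b c d q r).transpose =
      if p = q then T (K a a) + T (K b b) + T (K c c) + T (K d d) else 0 := by
  have h1 := K_rev_left b c
  have h2 := K_rev_left b d
  have h3 := K_rev_left c d
  have h (f g : ZMod v → ℤ) : K (rev f) g = K (rev g) f := by
    rw [← K_rev]
    congr 1
    ext x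
    simp [rev]
  have h4 := h b c
  have h5 := h b d
  have h6 := h c d
  fin_cases p <;> fin_cases q <;>
    simp [Fin.sum_univ_four, blk, S_transpose, S_mul_S, T_mul_S, S_mul_Tt, T_mul_Tt, K_rev,
      h1, h2, h3, h4, h5, h6, Matrix.transpose_neg] <;> abel

lemma blk_skew (a b c d : ZMod v → ℤ) (ha : T a + (T a).transpose = (2 : ℤ) • 1) (p q : Fin 4) :
    blk a b c d p q + (blk a b c d q p).transpose = if p = q then (2 : ℤ) • 1 else 0 := by
  fin_cases p <;> fin_cases q <;>
    simp [blk, S_transpose, Matrix.transpose_neg, ha, -smul_eq_mul]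

lemma blk_pm (a b c d : ZMod v → ℤ) (ha : ∀ x, a x = 1 ∨ a x = -1)
    (hb : ∀ x, b x = 1 ∨ b x = -1) (hc : ∀ x, c x = 1 ∨ c x = -1)
    (hd : ∀ x, d x = 1 ∨ d x = -1) (p q : Fin 4) (x y : ZMod v) :
    blk a b c d p q x y = 1 ∨ blk a b c d p q x y = -1 := by
  have hn : ∀ f : ZMod v → ℤ, (∀ x, f x = 1 ∨ f x = -1) → ∀ x y,
      (-S f) x y = 1 ∨ (-S f) x y = -1 := by
    intro f hf x y
    have h : (-S f) x y = -f (x + y) := rfl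
    rw [h]
    rcases hf (x + y) with h | h <;> simp [h]
  fin_cases p <;> fin_cases q
  · exact ha _
  · exact hb _
  · exact hc _
  · exact hd _
  · exact hn b hb x y
  · exact ha _
  · exact hd _
  · exact hn (rev c) (fun z => hc (-z)) x y
  · exact hn c hc x y
  · exact hn (rev d) (fun z => hd (-z)) x y
  · exact ha _
  · exact hb _
  · exact hn d hd x y
  · exact hc _
  · exact hn (rev b) (fun z => hb (-z)) x y
  · exact ha _

/-- Sign sequence of a block. -/
def sgn (X : Finset (ZMod v)) : ZMod v → ℤ := fun x => if x ∈ X then -1 else 1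

lemma sgn_pm (X : Finset (ZMod v)) (x : ZMod v) : sgn X x = 1 ∨ sgn X x = -1 := by
  unfold sgn
  split_ifs <;> simp

lemma count (X : Finset (ZMod v)) (c : ZMod v) :
    ∑ y, (if y ∈ X then (1 : ℤ) else 0) * (if y + c ∈ X then 1 else 0) =
      ((X ×ˢ X).filter (fun p => p.1 - p.2 = c)).card := by
  simp only [← ite_and, mul_ite, mul_one, mul_zero, Finset.sum_boole]
  norm_cast
  refine Finset.card_bij (fun y _ => (y + c, y)) ?_ ?_ ?_
  · intro y hy
    simp at hy ⊢
    tauto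
  · intro y _ z _ h
    exact (Prod.ext_iff.1 h).2
  · rintro ⟨x, y⟩ h
    simp only [Finset.mem_filter, Finset.mem_product] at h
    obtain ⟨⟨hx, hy⟩, rfl⟩ := h
    exact ⟨y, by simp [hx, hy], by simp⟩

lemma K_sgn (X : Finset (ZMod v)) (c : ZMod v) :
    K (sgn X) (sgn X) c =
      v - 4 * X.card + 4 * ((X ×ˢ X).filter (fun p => p.1 - p.2 = c)).card := by
  rw [← count]
  have h1 : ∑ y : ZMod v, (if y ∈ X then (1 : ℤ) else 0) = X.card := by simp
  have h2 : ∑ y : ZMod v, (if y + c ∈ X then (1 : ℤ) else 0) = X.card := by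
    rw [← h1]
    exact Fintype.sum_equiv (Equiv.addRight c) _ _ fun y => rfl
  have h0 : ∑ _y : ZMod v, (1 : ℤ) = v := by simp [ZMod.card]
  have : K (sgn X) (sgn X) c = ∑ y : ZMod v, (1 - 2 * (if y ∈ X then (1 : ℤ) else 0)
      - 2 * (if y + c ∈ X then (1 : ℤ) else 0)
      + 4 * ((if y ∈ X then (1 : ℤ) else 0) * (if y + c ∈ X then 1 else 0))) := by
    unfold K sgn
    refine Finset.sum_congr rfl fun y _ => ?_
    split_ifs <;> norm_num
  rw [this, Finset.sum_add_distrib, Finset.sum_sub_distrib, Finset.sum_sub_distrib,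
    ← Finset.mul_sum, ← Finset.mul_sum, ← Finset.mul_sum, h0, h1, h2]
  ring

lemma K_sgn_zero (X : Finset (ZMod v)) : K (sgn X) (sgn X) 0 = v := by
  have : ∀ y, sgn X y * sgn X (y + 0) = 1 := fun y => by
    rw [add_zero]
    rcases sgn_pm X y with h | h <;> simp [h]
  simp only [K, this]
  simp [ZMod.card]

end GSProof

open GSProof in
/-- Goethals–Seidel construction: an SDS `(X0, X1, X2, X3)` in `ZMod v` (`v` odd) with
parameters `(v; k0, k1, k2, k3; λ0)` of order `n0 = k0 + k1 + k2 + k3 - λ0 = v` whose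
first block is of skew type produces a skew-Hadamard matrix of order `4v`. -/
theorem skew_hadamard_from_sds (v : ℕ) [NeZero v] (hodd : Odd v) (hv : 1 < v)
    (X : Fin 4 → Finset (ZMod v)) (k : Fin 4 → ℕ) (lam : ℤ)
    (hX : IsSDS v 4 X k lam)
    (horder : (k 0 : ℤ) + (k 1 : ℤ) + (k 2 : ℤ) + (k 3 : ℤ) - lam = v)
    (hskew : IsSkewType v (X 0)) :
    ∃ H : Matrix (Fin (4 * v)) (Fin (4 * v)) ℤ,
      (∀ i j, H i j = 1 ∨ H i j = -1) ∧
      H * H.transpose = ((4 * v : ℕ) : ℤ) • (1 : Matrix (Fin (4 * v)) (Fin (4 * v)) ℤ) ∧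
      H + H.transpose = (2 : ℤ) • (1 : Matrix (Fin (4 * v)) (Fin (4 * v)) ℤ) := by
  obtain ⟨hk, hl⟩ := hX
  have hsum : T (K (sgn (X 0)) (sgn (X 0))) + T (K (sgn (X 1)) (sgn (X 1)))
      + T (K (sgn (X 2)) (sgn (X 2))) + T (K (sgn (X 3)) (sgn (X 3)))
      = ((4 * v : ℕ) : ℤ) • (1 : Matrix (ZMod v) (ZMod v) ℤ) := by
    ext x y
    by_cases hxy : x = y
    · subst hxy
      simp [T, K_sgn_zero]
      ring
    · have hc : y - x ≠ 0 := fun h => hxy (sub_eq_zero.1 h).symm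
      have := hl _ hc
      rw [Fin.sum_univ_four] at this
      push_cast at this
      simp only [T, Matrix.add_apply, Matrix.of_apply, K_sgn, hk, Matrix.smul_apply,
        Matrix.one_apply_ne hxy, smul_zero]
      linarith
  have ha : T (sgn (X 0)) + (T (sgn (X 0))).transpose = (2 : ℤ) • 1 := by
    ext x y
    by_cases hxy : x = y
    · subst hxy
      simp [T, sgn, hskew.1]
    · have hc : y - x ≠ 0 := fun h => hxy (sub_eq_zero.1 h).symm
      have := hskew.2 _ hc
      rw [neg_sub] at this
      rw [Matrix.smul_apply, Matrix.one_apply_ne hxy]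
      simp only [T, sgn, Matrix.add_apply, Matrix.of_apply, Matrix.transpose_apply]
      by_cases h : x - y ∈ X 0 <;> simp_all
  have e : Fin (4 * v) ≃ Fin 4 × ZMod v :=
    (Fintype.equivFinOfCardEq (by simp [ZMod.card])).symm
  let B := blk (sgn (X 0)) (sgn (X 1)) (sgn (X 2)) (sgn (X 3))
  refine ⟨Matrix.of fun i j => B (e i).1 (e j).1 (e i).2 (e j).2, ?_, ?_, ?_⟩
  · intro i j
    exact blk_pm _ _ _ _ (sgn_pm _) (sgn_pm _) (sgn_pm _) (sgn_pm _) _ _ _ _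
  · ext i j
    have hg := congrFun (congrFun (blk_gram (sgn (X 0)) (sgn (X 1)) (sgn (X 2)) (sgn (X 3))
      (e i).1 (e j).1) (e i).2) (e j).2
    rw [hsum] at hg
    have h1 : (1 : Matrix (Fin (4 * v)) (Fin (4 * v)) ℤ) i j =
        if (e i).1 = (e j).1 then (1 : Matrix (ZMod v) (ZMod v) ℤ) (e i).2 (e j).2 else 0 := by
      rw [Matrix.one_apply, Matrix.one_apply, ← ite_and]
      congr 1
      rw [← Prod.ext_iff, e.injective.eq_iff]
    rw [Matrix.smul_apply, h1, Matrix.mul_apply]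
    refine (e.sum_comp (fun r => B (e i).1 r.1 (e i).2 r.2 * B (e j).1 r.1 (e j).2 r.2)).trans ?_
    rw [Fintype.sum_prod_type]
    rw [Matrix.sum_apply] at hg
    simp only [Matrix.mul_apply, Matrix.transpose_apply] at hg
    refine hg.trans ?_
    split_ifs <;> simp
  · ext i j
    have hg := congrFun (congrFun (blk_skew (sgn (X 0)) (sgn (X 1)) (sgn (X 2)) (sgn (X 3)) ha
      (e i).1 (e j).1) (e i).2) (e j).2
    have h1 : (1 : Matrix (Fin (4 * v)) (Fin (4 * v)) ℤ) i j =
        if (e i).1 = (e j).1 then (1 : Matrix (ZMod v) (ZMod v) ℤ) (e i).2 (e j).2 else 0 := by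
      rw [Matrix.one_apply, Matrix.one_apply, ← ite_and]
      congr 1
      rw [← Prod.ext_iff, e.injective.eq_iff]
    rw [Matrix.smul_apply, h1]
    refine hg.trans ?_
    split_ifs <;> simp
end

section
/- There exists a skew-Hadamard matrix of order 956 = 4·239, i.e. a 956 × 956 matrix H with all entries ±1 such that H·Hᵀ = 956·I and H + Hᵀ = 2·I. -/
namespace SkewHad

/-! The four base blocks (orbits of the subgroup of order 7 of the units of `ZMod 239`),
encoded as 239-bit masks; a set bit marks an entry `-1`. -/

def mA : ℕ := 266507006492565149880637398151653189973843280656147233668330734482179738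
def mB : ℕ := 426589975073576265712435391748632627941769966493329522361187376896613490
def mC : ℕ := 352485329477658770496611925174724129381146673519986162005277009814913432
def mD : ℕ := 402479289117058262731751511689876334005474633085694647375889824685813463

/-- Sequence encoded by a mask. -/
def sq (m : ℕ) (x : ZMod 239) : ℤ := if m.testBit x.val then -1 else 1

/-- Number of ones among the lowest `n` bits. -/
def pop : ℕ → ℕ → ℕ
  | 0, _ => 0
  | n + 1, y => y % 2 + pop n (y / 2)

/-- The mask, repeated twice. -/
def dbl (m : ℕ) : ℕ := m + m * 2 ^ 239

/-- Number of disagreements of the sequence and its shift. -/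
def dis (m s : ℕ) : ℕ := pop 239 (m ^^^ (dbl m >>> s))

theorem pop_eq (n y : ℕ) : pop n y = ∑ k ∈ Finset.range n, (y.testBit k).toNat := by
  induction n generalizing y with
  | zero => simp [pop]
  | succ n ih =>
    rw [Finset.sum_range_succ', pop, ih, add_comm]
    congr 1
    · refine Finset.sum_congr rfl fun k _ => ?_
      rw [Nat.testBit_succ]
    · rw [Nat.testBit_zero]
      rcases Nat.mod_two_eq_zero_or_one y with h | h <;> simp [h]

def okDbl (m : ℕ) : Prop := ∀ k < 478, (dbl m).testBit k = m.testBit (k % 239)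

instance (m : ℕ) : Decidable (okDbl m) := by unfold okDbl; infer_instance

theorem okA : okDbl mA := by decide +kernel
theorem okB : okDbl mB := by decide +kernel
theorem okC : okDbl mC := by decide +kernel
theorem okD : okDbl mD := by decide +kernel

theorem autocorr (m : ℕ) (h : okDbl m) (s : ZMod 239) :
    ∑ k, sq m k * sq m (k + s) = 239 - 2 * (dis m s.val : ℤ) := by
  have h1 : ∀ k : ZMod 239, sq m k * sq m (k + s)
      = 1 - 2 * (((m ^^^ (dbl m >>> s.val)).testBit k.val).toNat : ℤ) := by
    intro k
    have hk := ZMod.val_lt k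
    have hs := ZMod.val_lt s
    rw [Nat.testBit_xor, Nat.testBit_shiftRight, h _ (by omega)]
    unfold sq
    rw [ZMod.val_add, add_comm s.val]
    cases m.testBit k.val <;> cases m.testBit ((k.val + s.val) % 239) <;> simp
  rw [Finset.sum_congr rfl fun k _ => h1 k, Finset.sum_sub_distrib, ← Finset.mul_sum, dis, pop_eq]
  have h2 : ∑ _k : ZMod 239, (1 : ℤ) = 239 := by simp [ZMod.card]
  have h3 : ∑ k : ZMod 239, (((m ^^^ (dbl m >>> s.val)).testBit k.val).toNat : ℤ)
      = ∑ k ∈ Finset.range 239, (((m ^^^ (dbl m >>> s.val)).testBit k).toNat : ℤ) :=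
    Fin.sum_univ_eq_sum_range
      (fun k => (((m ^^^ (dbl m >>> s.val)).testBit k).toNat : ℤ)) 239
  rw [h2, h3, Nat.cast_sum]

/-- It is enough to test one shift per orbit: the powers of the primitive root 7. -/
theorem dis_total : ∀ t < 34,
    dis mA (7 ^ t % 239) + dis mB (7 ^ t % 239) + dis mC (7 ^ t % 239) + dis mD (7 ^ t % 239)
      = 478 := by
  decide +kernel

theorem val_pow : ∀ t < 34, ((7 : ZMod 239) ^ t).val = 7 ^ t % 239 := by
  intro t _
  have : ((7 : ZMod 239) ^ t) = ((7 ^ t : ℕ) : ZMod 239) := by push_cast; rfl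
  rw [this, ZMod.val_natCast]

theorem orbit : ∀ s : ZMod 239, s ≠ 0 → ∃ u < 7, ∃ t < 34, s = 24 ^ u * 7 ^ t := by
  decide +kernel

theorem invA : ∀ x : ZMod 239, sq mA (24 * x) = sq mA x := by decide +kernel
theorem invB : ∀ x : ZMod 239, sq mB (24 * x) = sq mB x := by decide +kernel
theorem invC : ∀ x : ZMod 239, sq mC (24 * x) = sq mC x := by decide +kernel
theorem invD : ∀ x : ZMod 239, sq mD (24 * x) = sq mD x := by decide +kernel

theorem unit_eq : (24 : ZMod 239) * 10 = 1 := by decide +kernel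

theorem corr_inv (f : ZMod 239 → ℤ) (h : ∀ x, f (24 * x) = f x) (s : ZMod 239) (u : ℕ) :
    ∑ k, f k * f (k + 24 ^ u * s) = ∑ k, f k * f (k + s) := by
  induction u with
  | zero => simp
  | succ u ih =>
    rw [← ih]
    have hu := unit_eq
    refine (Fintype.sum_equiv (Units.mulLeft ⟨24, 10, hu, by rw [mul_comm]; exact hu⟩)
      _ _ fun k => ?_).symm
    simp only [Units.mulLeft_apply]
    rw [h, pow_succ', mul_assoc, ← mul_add, h]

theorem skewA : ∀ x : ZMod 239, x ≠ 0 → sq mA (-x) = - sq mA x := by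
  decide +kernel

theorem sq_pm (m : ℕ) (x : ZMod 239) : sq m x = 1 ∨ sq m x = -1 := by
  unfold sq; split <;> simp

theorem sq_mul_self (m : ℕ) (x : ZMod 239) : sq m x * sq m x = 1 := by
  rcases sq_pm m x with h | h <;> simp [h]

theorem total (s : ZMod 239) :
    (∑ k, sq mA k * sq mA (k + s)) + (∑ k, sq mB k * sq mB (k + s))
      + (∑ k, sq mC k * sq mC (k + s)) + (∑ k, sq mD k * sq mD (k + s))
      = if s = 0 then 956 else 0 := by
  split_ifs with h
  · subst h
    simp [sq_mul_self, ZMod.card]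
  · obtain ⟨u, -, t, ht, rfl⟩ := orbit s h
    rw [corr_inv _ invA, corr_inv _ invB, corr_inv _ invC, corr_inv _ invD,
      autocorr _ okA, autocorr _ okB, autocorr _ okC, autocorr _ okD, val_pow t ht]
    have := dis_total t ht
    zify at this
    linarith

/-- The Goethals–Seidel array. -/
def gs (a b c d : ZMod 239 → ℤ) (p q : Fin 4) (i j : ZMod 239) : ℤ :=
  match p, q with
  | 0, 0 => a (j - i)
  | 0, 1 => b (-i - j)
  | 0, 2 => c (-i - j)
  | 0, 3 => d (-i - j)
  | 1, 0 => -b (-i - j)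
  | 1, 1 => a (j - i)
  | 1, 2 => d (i + j)
  | 1, 3 => -c (i + j)
  | 2, 0 => -c (-i - j)
  | 2, 1 => -d (i + j)
  | 2, 2 => a (j - i)
  | 2, 3 => b (i + j)
  | 3, 0 => -d (-i - j)
  | 3, 1 => c (i + j)
  | 3, 2 => -b (i + j)
  | 3, 3 => a (j - i)

section
variable (f g : ZMod 239 → ℤ) (i j : ZMod 239)

/-- Substitution of the summation index by a translate. -/
theorem sum_tr (F : ZMod 239 → ℤ) (t : ZMod 239) : ∑ k, F k = ∑ k, F (k + t) :=
  (Equiv.sum_comp (Equiv.addRight t) F).symm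

/-- Substitution of the summation index by a reflection. -/
theorem sum_rf (F : ZMod 239 → ℤ) (t : ZMod 239) : ∑ k, F k = ∑ k, F (t - k) :=
  (Equiv.sum_comp (Equiv.subLeft t) F).symm

theorem s1 : ∑ k, f (k - i) * f (k - j) = ∑ k, f k * f (k + (i - j)) := by
  rw [sum_tr _ i]
  refine Finset.sum_congr rfl fun k _ => ?_
  ring_nf

theorem s2 : ∑ k, f (-i - k) * f (-j - k) = ∑ k, f k * f (k + (i - j)) := by
  rw [sum_rf _ (-i)]
  refine Finset.sum_congr rfl fun k _ => ?_
  ring_nf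

theorem s3 : ∑ k, f (i + k) * f (j + k) = ∑ k, f k * f (k + (i - j)) := by
  rw [sum_tr _ (-j)]
  refine Finset.sum_congr rfl fun k _ => ?_
  ring_nf

theorem c1 : ∑ k, f (k - i) * g (-j - k) = ∑ k, g (-i - k) * f (k - j) := by
  rw [sum_tr _ (i - j)]
  refine Finset.sum_congr rfl fun k _ => ?_
  ring_nf

theorem c2 : ∑ k, f (-i - k) * g (j + k) = ∑ k, g (-i - k) * f (j + k) := by
  rw [sum_rf _ (-i - j)]
  refine Finset.sum_congr rfl fun k _ => ?_
  ring_nf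

theorem c3 : ∑ k, f (i + k) * g (-j - k) = ∑ k, g (i + k) * f (-j - k) := by
  rw [sum_rf _ (-i - j)]
  refine Finset.sum_congr rfl fun k _ => ?_
  ring_nf

theorem c4 : ∑ k, f (k - i) * g (j + k) = ∑ k, g (i + k) * f (k - j) := by
  rw [sum_tr _ (i - j)]
  refine Finset.sum_congr rfl fun k _ => ?_
  ring_nf

theorem c5 : ∑ k, f (-i - k) * g (-j - k) = ∑ k, g (i + k) * f (j + k) := by
  rw [sum_rf _ (-i - j)]
  refine Finset.sum_congr rfl fun k _ => ?_
  ring_nf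

end

theorem gs_mul (a b c d : ZMod 239 → ℤ) (p q : Fin 4) (i j : ZMod 239) :
    ∑ r, ∑ k, gs a b c d p r i k * gs a b c d q r j k =
      if p = q then (∑ k, a k * a (k + (i - j))) + (∑ k, b k * b (k + (i - j)))
        + (∑ k, c k * c (k + (i - j))) + (∑ k, d k * d (k + (i - j))) else 0 := by
  fin_cases p <;> fin_cases q <;>
    simp only [Fin.sum_univ_four, gs, Fin.zero_eta, Fin.mk_one, Fin.reduceFinMk, Fin.reduceEq,
      if_true, if_false, neg_mul, mul_neg, neg_neg, Finset.sum_neg_distrib, s1, s2, s3]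
  all_goals
    linarith [c1 a b i j, c1 a c i j, c1 a d i j, c1 a b j i, c1 a c j i, c1 a d j i,
      c2 b c i j, c2 b d i j, c2 c d i j, c3 b c i j, c3 b d i j, c3 c d i j,
      c4 a b i j, c4 a c i j, c4 a d i j, c4 a b j i, c4 a c j i, c4 a d j i,
      c5 b c i j, c5 b d i j, c5 c d i j, c5 c b i j, c5 d b i j, c5 d c i j]

end SkewHad

open SkewHad

/-- There exists a skew-Hadamard matrix of order `956 = 4·239`. -/
theorem exists_skew_hadamard_956 :
    ∃ H : Matrix (Fin 956) (Fin 956) ℤ,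
      (∀ i j, H i j = 1 ∨ H i j = -1) ∧
      H * H.transpose = (956 : ℤ) • (1 : Matrix (Fin 956) (Fin 956) ℤ) ∧
      H + H.transpose = (2 : ℤ) • (1 : Matrix (Fin 956) (Fin 956) ℤ) := by
  let e : Fin 956 ≃ Fin 4 × ZMod 239 := (finProdFinEquiv (m := 4) (n := 239)).symm
  let G := gs (sq mA) (sq mB) (sq mC) (sq mD)
  refine ⟨Matrix.of fun x y => G (e x).1 (e y).1 (e x).2 (e y).2, ?_, ?_, ?_⟩
  · intro x y
    show G (e x).1 (e y).1 (e x).2 (e y).2 = 1 ∨ G (e x).1 (e y).1 (e x).2 (e y).2 = -1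
    generalize e x = u
    generalize e y = v
    obtain ⟨p, i⟩ := u
    obtain ⟨q, j⟩ := v
    have hn : ∀ m t, -sq m t = 1 ∨ -sq m t = -1 := by
      intro m t
      rcases sq_pm m t with h | h <;> simp [h]
    fin_cases p <;> fin_cases q <;> first | exact sq_pm _ _ | exact hn _ _
  · ext x y
    have h1 : ∑ z, G (e x).1 (e z).1 (e x).2 (e z).2 * G (e y).1 (e z).1 (e y).2 (e z).2
        = ∑ r, ∑ k, G (e x).1 r (e x).2 k * G (e y).1 r (e y).2 k := by
      rw [← Fintype.sum_prod_type'
        (f := fun r k => G (e x).1 r (e x).2 k * G (e y).1 r (e y).2 k)]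
      exact e.sum_comp (fun w => G (e x).1 w.1 (e x).2 w.2 * G (e y).1 w.1 (e y).2 w.2)
    rw [Matrix.mul_apply]
    refine h1.trans ?_
    rw [gs_mul, total, Matrix.smul_apply, Matrix.one_apply]
    have h2 : x = y ↔ (e x).1 = (e y).1 ∧ (e x).2 = (e y).2 := by
      rw [← Prod.ext_iff, e.apply_eq_iff_eq]
    simp only [h2, sub_eq_zero]
    split_ifs <;> simp_all
  · ext x y
    rw [Matrix.add_apply, Matrix.transpose_apply, Matrix.smul_apply, Matrix.one_apply,
      Matrix.of_apply, Matrix.of_apply]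
    have h2 : x = y ↔ e x = e y := by rw [e.apply_eq_iff_eq]
    simp only [h2]
    generalize e x = u
    generalize e y = v
    obtain ⟨p, i⟩ := u
    obtain ⟨q, j⟩ := v
    have hA : sq mA (j - i) + sq mA (i - j) = if i = j then 2 else 0 := by
      split_ifs with h
      · subst h
        rw [sub_self]
        decide +kernel
      · rw [← neg_sub j i, skewA _ (by rw [sub_ne_zero]; exact fun h' => h h'.symm)]
        ring
    have e1 : -i - j = -j - i := by ring
    have e2 : i + j = j + i := by ring
    fin_cases p <;> fin_cases q <;>
      simp [G, gs, hA, e1, e2]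
end

section
/- There exists a skew-Hadamard matrix of order 1324 = 4·331, i.e. a 1324 × 1324 matrix H with all entries ±1 such that H·Hᵀ = 1324·I and H + Hᵀ = 2·I. -/
/-- The bordered two-circulant matrix. -/
def skewMat {F : Type*} [AddCommGroup F] (a b : F → ℤ) :
    (Unit ⊕ Unit) ⊕ (F ⊕ F) → (Unit ⊕ Unit) ⊕ (F ⊕ F) → ℤ
  | .inl (.inl _), .inl (.inl _) => 1
  | .inl (.inl _), .inl (.inr _) => 1
  | .inl (.inr _), .inl (.inl _) => -1
  | .inl (.inr _), .inl (.inr _) => 1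
  | .inl (.inl _), .inr (.inl _) => -1
  | .inl (.inl _), .inr (.inr _) => -1
  | .inl (.inr _), .inr (.inl _) => -1
  | .inl (.inr _), .inr (.inr _) => 1
  | .inr (.inl _), .inl (.inl _) => 1
  | .inr (.inl _), .inl (.inr _) => 1
  | .inr (.inr _), .inl (.inl _) => 1
  | .inr (.inr _), .inl (.inr _) => -1
  | .inr (.inl x), .inr (.inl y) => a (y - x)
  | .inr (.inl x), .inr (.inr y) => b (y - x)
  | .inr (.inr x), .inr (.inl y) => - b (x - y)
  | .inr (.inr x), .inr (.inr y) => a (x - y)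

section
variable {F : Type*} [AddCommGroup F] [Fintype F]

lemma sum_shift (a : F → ℤ) (x : F) : ∑ z, a (z - x) = ∑ z, a z :=
  (Equiv.subRight x).sum_comp a

lemma sum_refl (a : F → ℤ) (x : F) : ∑ z, a (x - z) = ∑ z, a z :=
  (Equiv.subLeft x).sum_comp a

lemma skewMat_mul [DecidableEq F] (a b : F → ℤ)
    (ha : ∀ x, a x = 1 ∨ a x = -1) (hb : ∀ x, b x = 1 ∨ b x = -1)
    (sa : ∑ x, a x = 1) (sb : ∑ x, b x = 1)
    (hab : ∀ d, d ≠ 0 → ∑ x, (a x * a (x + d) + b x * b (x + d)) = -2)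
    (i j : (Unit ⊕ Unit) ⊕ (F ⊕ F)) :
    ∑ k, skewMat a b i k * skewMat a b j k =
      if i = j then 2 * (Fintype.card F : ℤ) + 2 else 0 := by
  have aa : ∀ x, a x * a x = 1 := fun x => by rcases ha x with h | h <;> simp [h]
  have bb : ∀ x, b x * b x = 1 := fun x => by rcases hb x with h | h <;> simp [h]
  have c1 : ∀ x y : F, x ≠ y →
      ∑ z, a (z - x) * a (z - y) + ∑ z, b (z - x) * b (z - y) = -2 := by
    intro x y hxy
    rw [← Finset.sum_add_distrib, ← hab (x - y) (sub_ne_zero.2 hxy),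
      ← (Equiv.subRight x).sum_comp (fun z => a z * a (z + (x - y)) + b z * b (z + (x - y)))]
    simp
  have c2 : ∀ x y : F, x ≠ y →
      ∑ z, b (x - z) * b (y - z) + ∑ z, a (x - z) * a (y - z) = -2 := by
    intro x y hxy
    rw [← Finset.sum_add_distrib, ← hab (y - x) (sub_ne_zero.2 hxy.symm),
      ← (Equiv.subLeft x).sum_comp (fun z => a z * a (z + (y - x)) + b z * b (z + (y - x)))]
    refine Finset.sum_congr rfl fun z _ => ?_
    have : x - z + (y - x) = y - z := by abel
    simp [this, add_comm]
  have c3 : ∀ x y : F, ∑ z, a (z - x) * b (y - z) = ∑ z, b (z - x) * a (y - z) := by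
    intro x y
    rw [← (Equiv.subLeft (x + y)).sum_comp (fun z => b (z - x) * a (y - z))]
    refine Finset.sum_congr rfl fun z _ => ?_
    have h1 : x + y - z - x = y - z := by abel
    have h2 : y - (x + y - z) = z - x := by abel
    simp [h1, h2, mul_comm]
  have c4 : ∀ x y : F, ∑ z, b (y - z) * a (z - x) = ∑ z, a (y - z) * b (z - x) := by
    intro x y
    simpa [mul_comm] using c3 x y
  rcases i with (_ | _) | (x | x) <;> rcases j with (_ | _) | (y | y) <;>
    simp only [Fintype.sum_sum_type, skewMat, Finset.univ_unique, Finset.sum_singleton,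
      Finset.sum_const, Finset.card_univ, mul_one, one_mul, mul_neg, neg_mul, neg_neg,
      Finset.sum_neg_distrib, sum_shift, sum_refl, sa, sb, nsmul_eq_mul]
  all_goals try (simp <;> ring1)
  · by_cases h : x = y
    · subst h; simp [aa, bb]; ring
    · have := c1 x y h; simp [h]; linarith
  · have := c3 x y; rw [if_neg (by simp)]; linarith
  · have := c4 y x; rw [if_neg (by simp)]; linarith
  · by_cases h : x = y
    · subst h; simp [aa, bb]; ring
    · have := c2 x y h; simp [h]; linarith
end

lemma skewMat_skew {F : Type*} [AddCommGroup F] [DecidableEq F] (a b : F → ℤ)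
    (a0 : a 0 = 1) (an : ∀ x, x ≠ 0 → a (-x) = - a x)
    (i j : (Unit ⊕ Unit) ⊕ (F ⊕ F)) :
    skewMat a b i j + skewMat a b j i = if i = j then 2 else 0 := by
  have key : ∀ x y : F, a (y - x) + a (x - y) = if x = y then 2 else 0 := by
    intro x y
    by_cases h : x = y
    · subst h; simp [a0]
    · have := an (x - y) (sub_ne_zero.2 h)
      rw [neg_sub] at this
      simp [h, this]
  rcases i with (_ | _) | (x | x) <;> rcases j with (_ | _) | (y | y) <;>
    simp [skewMat, key]
  simp [eq_comm]

lemma skewMat_pm {F : Type*} [AddCommGroup F] (a b : F → ℤ)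
    (ha : ∀ x, a x = 1 ∨ a x = -1) (hb : ∀ x, b x = 1 ∨ b x = -1)
    (i j : (Unit ⊕ Unit) ⊕ (F ⊕ F)) :
    skewMat a b i j = 1 ∨ skewMat a b i j = -1 := by
  rcases i with (_ | _) | (x | x) <;> rcases j with (_ | _) | (y | y) <;>
    simp [skewMat, ha, hb]
  have := hb (x - y)
  omega

lemma gauss_prim : IsPrimitiveRoot (⟨0, 1⟩ : GaussianInt) 4 := by
  refine IsPrimitiveRoot.mk_of_lt _ (by norm_num) (by decide) ?_
  intro l h1 h2
  interval_cases l <;> decide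

lemma gauss_unit (w : GaussianInt) (hw : w ^ 4 = 1) : w.re * w.re + w.im * w.im = 1 := by
  have h : Zsqrtd.norm w ^ 4 = 1 := by
    have := congrArg Zsqrtd.normMonoidHom hw
    rw [map_pow, map_one] at this
    exact this
  have h0 : 0 ≤ Zsqrtd.norm w := Zsqrtd.norm_nonneg (by norm_num) w
  have : Zsqrtd.norm w = 1 := (pow_eq_one_iff_of_nonneg h0 (by norm_num)).1 h
  simpa [Zsqrtd.norm_def] using this

lemma gauss_pm (r s : ℤ) (h : r * r + s * s = 1) :
    (r + s = 1 ∨ r + s = -1) ∧ (r - s = 1 ∨ r - s = -1) := by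
  have h1 : r ≤ 1 := by nlinarith
  have h2 : -1 ≤ r := by nlinarith
  have h3 : s ≤ 1 := by nlinarith
  have h4 : -1 ≤ s := by nlinarith
  interval_cases r <;> interval_cases s <;> simp_all

instance fact661 : Fact (Nat.Prime 661) := ⟨by norm_num⟩

lemma exists_char : ∃ χ : MulChar (ZMod 661) GaussianInt,
    χ ≠ 1 ∧ χ (-1) = -1 ∧ ∀ x, x ≠ 0 → χ x ^ 4 = 1 := by
  obtain ⟨χ, hχ⟩ := MulChar.exists_mulChar_orderOf (ZMod 661) (n := 4)
    (by rw [ZMod.card]; norm_num) gauss_prim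
  have h4 : ∀ x, x ≠ 0 → χ x ^ 4 = 1 := by
    intro x hx
    have h : χ ^ 4 = 1 := hχ ▸ pow_orderOf_eq_one χ
    rw [← MulChar.pow_apply' χ (by norm_num), h, MulChar.one_apply hx.isUnit]
  refine ⟨χ, ?_, ?_, h4⟩
  · rintro rfl
    simp at hχ
  obtain ⟨g, hg⟩ := IsCyclic.exists_generator (α := (ZMod 661)ˣ)
  have ho : orderOf g = 660 := by
    rw [orderOf_eq_card_of_forall_mem_zpowers hg, Nat.card_eq_fintype_card, ZMod.card_units]
  have hz : χ (g : ZMod 661) ^ 2 ≠ 1 := by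
    intro h
    have : χ ^ 2 = 1 := by
      refine MulChar.ext fun u => ?_
      obtain ⟨k, rfl⟩ := (Submonoid.mem_powers_iff _ _).1
        ((mem_powers_iff_mem_zpowers).2 (hg u))
      rw [MulChar.pow_apply' χ (by norm_num), MulChar.one_apply_coe]
      push_cast
      rw [map_pow, ← pow_mul, mul_comm, pow_mul, h, one_pow]
    have := orderOf_dvd_of_pow_eq_one this
    rw [hχ] at this
    norm_num at this
  have hz4 := h4 g g.ne_zero
  have hz2 : χ (g : ZMod 661) ^ 2 = -1 := by
    have : (χ (g : ZMod 661) ^ 2 - 1) * (χ (g : ZMod 661) ^ 2 + 1) = 0 := by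
      linear_combination hz4
    rcases mul_eq_zero.1 this with h | h
    · exact absurd (sub_eq_zero.1 h) hz
    · exact eq_neg_of_add_eq_zero_left h
  have hg1 : (g : ZMod 661) ^ 330 = -1 := by
    have h1 : (g : ZMod 661) ^ 660 = 1 := by
      have := pow_orderOf_eq_one g
      rw [ho] at this
      rw [← Units.val_pow_eq_pow_val, this, Units.val_one]
    have h2 : (g : ZMod 661) ^ 330 ≠ 1 := by
      intro h
      have : g ^ 330 = 1 := by
        refine Units.ext ?_
        rw [Units.val_pow_eq_pow_val]
        exact h
      have := orderOf_dvd_of_pow_eq_one this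
      rw [ho] at this
      norm_num at this
    have h3 : ((g : ZMod 661) ^ 330) * ((g : ZMod 661) ^ 330) = 1 := by
      rw [← pow_add]; exact h1
    exact (mul_self_eq_one_iff.1 h3).resolve_left h2
  have e : (330 : ℕ) = 2 * 165 := by norm_num
  rw [← hg1, map_pow, e, pow_mul, hz2]
  exact Odd.neg_one_pow (by decide)

lemma char_corr (χ : MulChar (ZMod 661) GaussianInt) (h1 : χ ≠ 1)
    (h4 : ∀ x, x ≠ 0 → χ x ^ 4 = 1) (d : ZMod 661) (hd : d ≠ 0) :
    ∑ x, χ (x + d) * star (χ x) = -1 := by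
  have hst : ∀ x, x ≠ 0 → χ x * star (χ x) = 1 := by
    intro x hx
    have := gauss_unit _ (h4 x hx)
    ext
    · simp; linarith
    · simp; ring
  have key : ∀ x, χ (x + d) * star (χ x) = χ (1 + d * x⁻¹) - if x = 0 then 1 else 0 := by
    intro x
    by_cases hx : x = 0
    · subst hx; simp [MulChar.map_zero χ]
    · have : x + d = (1 + d * x⁻¹) * x := by field_simp
      rw [this, map_mul, mul_assoc, hst x hx]
      simp [hx]
  have bij : Function.Bijective (fun x : ZMod 661 => 1 + d * x⁻¹) := by
    refine Finite.injective_iff_bijective.1 fun x y h => ?_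
    simpa [hd] using h
  rw [Finset.sum_congr rfl fun x _ => key x, Finset.sum_sub_distrib,
    bij.sum_comp (fun y => χ y), MulChar.sum_eq_zero_of_ne_one h1]
  simp

lemma exists_seq : ∃ a b : ZMod 661 → ℤ,
    (∀ x, a x = 1 ∨ a x = -1) ∧ (∀ x, b x = 1 ∨ b x = -1) ∧
    (∑ x, a x = 1) ∧ (∑ x, b x = 1) ∧
    (∀ d, d ≠ 0 → ∑ x, (a x * a (x + d) + b x * b (x + d)) = -2) ∧
    a 0 = 1 ∧ ∀ x, x ≠ 0 → a (-x) = - a x := by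
  obtain ⟨χ, h1, hn, h4⟩ := exists_char
  have h0 : χ 0 = 0 := MulChar.map_zero χ
  have hneg : ∀ x, χ (-x) = - χ x := fun x => by
    rw [← neg_one_mul x, map_mul, hn, neg_one_mul]
  have hs : ∑ x, χ x = 0 := MulChar.sum_eq_zero_of_ne_one h1
  let re : GaussianInt →+ ℤ := ⟨⟨Zsqrtd.re, rfl⟩, fun _ _ => rfl⟩
  let im : GaussianInt →+ ℤ := ⟨⟨Zsqrtd.im, rfl⟩, fun _ _ => rfl⟩
  have hsr : ∑ x, (χ x).re = 0 := by
    have := congrArg re hs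
    rw [map_sum, map_zero] at this
    exact this
  have hsi : ∑ x, (χ x).im = 0 := by
    have := congrArg im hs
    rw [map_sum, map_zero] at this
    exact this
  have hc : ∀ d, d ≠ 0 →
      ∑ x, ((χ x).re * (χ (x + d)).re + (χ x).im * (χ (x + d)).im) = -1 := by
    intro d hd
    have := congrArg re (char_corr χ h1 h4 d hd)
    rw [map_sum] at this
    refine Eq.trans (Finset.sum_congr rfl fun x _ => ?_) this
    change _ = (χ (x + d) * star (χ x)).re
    simp
    ring
  refine ⟨fun x => (χ x).re + (χ x).im + if x = 0 then 1 else 0,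
    fun x => (χ x).re - (χ x).im + if x = 0 then 1 else 0, ?_, ?_, ?_, ?_, ?_, ?_, ?_⟩
  · intro x
    by_cases hx : x = 0
    · simp [hx, h0]
    · simpa [hx] using (gauss_pm _ _ (gauss_unit _ (h4 x hx))).1
  · intro x
    by_cases hx : x = 0
    · simp [hx, h0]
    · simpa [hx] using (gauss_pm _ _ (gauss_unit _ (h4 x hx))).2
  · simp [Finset.sum_add_distrib, hsr, hsi]
  · simp [Finset.sum_add_distrib, Finset.sum_sub_distrib, hsr, hsi]
  · intro d hd
    have e : ∀ x : ZMod 661,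
        ((χ x).re + (χ x).im + if x = 0 then 1 else 0) *
          ((χ (x + d)).re + (χ (x + d)).im + if x + d = 0 then 1 else 0) +
        ((χ x).re - (χ x).im + if x = 0 then 1 else 0) *
          ((χ (x + d)).re - (χ (x + d)).im + if x + d = 0 then 1 else 0) =
        2 * ((χ x).re * (χ (x + d)).re + (χ x).im * (χ (x + d)).im) +
          ((if x = 0 then 2 * (χ d).re else 0) +
            (if x = -d then 2 * (χ (-d)).re else 0)) := by
      intro x
      by_cases hx : x = 0
      · subst hx
        have : ¬ (0 = -d) := fun h => hd (by simpa using h.symm)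
        simp [h0, hd, this]
        ring
      · by_cases hx2 : x = -d
        · subst hx2
          simp [h0, hd]
          ring
        · have : ¬ (x + d = 0) := fun h => hx2 (eq_neg_of_add_eq_zero_left h)
          simp [hx, hx2, this]
          ring
    simp only [e]
    rw [Finset.sum_add_distrib, ← Finset.mul_sum, hc d hd, Finset.sum_add_distrib]
    simp [hneg]
  · simp [h0]
  · intro x hx
    simp [hx, hneg]
    ring

/-- There exists a skew-Hadamard matrix of order `1324 = 4·331`. -/
theorem exists_skew_hadamard_1324 :
    ∃ H : Matrix (Fin 1324) (Fin 1324) ℤ,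
      (∀ i j, H i j = 1 ∨ H i j = -1) ∧
      H * H.transpose = (1324 : ℤ) • (1 : Matrix (Fin 1324) (Fin 1324) ℤ) ∧
      H + H.transpose = (2 : ℤ) • (1 : Matrix (Fin 1324) (Fin 1324) ℤ) := by
  obtain ⟨a, b, ha, hb, sa, sb, hab, a0, an⟩ := exists_seq
  have hcard : Fintype.card ((Unit ⊕ Unit) ⊕ (ZMod 661 ⊕ ZMod 661)) = 1324 := by
    simp [ZMod.card]
  let e := (Fintype.equivFinOfCardEq hcard).symm
  refine ⟨Matrix.of fun i j => skewMat a b (e i) (e j), ?_, ?_, ?_⟩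
  · intro i j
    exact skewMat_pm a b ha hb _ _
  · ext i j
    rw [Matrix.mul_apply]
    simp only [Matrix.of_apply, Matrix.transpose_apply, Matrix.smul_apply, Matrix.one_apply]
    rw [e.sum_comp (fun k => skewMat a b (e i) k * skewMat a b (e j) k),
      skewMat_mul a b ha hb sa sb hab]
    simp [ZMod.card]
  · ext i j
    simp only [Matrix.of_apply, Matrix.transpose_apply, Matrix.smul_apply, Matrix.one_apply,
      Matrix.add_apply]
    rw [skewMat_skew a b a0 an]
    simp
end

section
/- Let H = {1, 10, 24, 44, 98, 100, 201} ⊆ Z_239, a subgroup of order 7 of Z_239^*, and set X1 = ⋃_{j ∈ J} H·j, X2 = ⋃_{k ∈ K} H·k, X3 = ⋃_{l ∈ L} H·l, where J = {1,3,5,6,15,17,19,28,34,38,39,57,58,63,85,95,107}, K = {1,3,4,5,15,16,17,18,19,21,23,29,35,45,58,63}, L = {0,1,4,6,7,8,13,16,18,34,35,45,47,58,63,95}. Then (X1, X2, X3) is a supplementary difference set in Z_239 with parameters (239; 119, 112, 106; 158). -/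
/-- Bit masks of the three base blocks. -/
def maskA : ℕ := 878115240865183770486515194984012112927296381444286428298424711973084266

def maskB : ℕ := 91773993642698987807083218523587314619506110969640208565948891849004090

def maskC : ℕ := 73081712051521824243793222844659816780995602499226795324452264216964563

/-- The `n`-th bit of `M`, as a number. -/
def bitAt (M n : ℕ) : ℕ := M / 2 ^ n % 2

/-- Number of `x < n` with `x` and `x + c` (mod 239) both in the set with mask `M`. -/
def cnt (M c n : ℕ) : ℕ :=
  Nat.rec 0 (fun x r => r + bitAt M x * bitAt M ((x + c) % 239)) n

theorem cnt_eq (M c n : ℕ) :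
    cnt M c n = ∑ x ∈ Finset.range n, bitAt M x * bitAt M ((x + c) % 239) := by
  induction n with
  | zero => rfl
  | succ k ih => rw [Finset.sum_range_succ, ← ih]; rfl

/-- The subset of `ZMod 239` with mask `M`. -/
def maskSet (M : ℕ) : Finset (ZMod 239) := Finset.univ.filter (fun x => bitAt M x.val = 1)

theorem bitAt_ite (M n : ℕ) : bitAt M n = if bitAt M n = 1 then 1 else 0 := by
  have : bitAt M n < 2 := Nat.mod_lt _ (by norm_num)
  split_ifs <;> omega

theorem sum_zmod (f : ℕ → ℕ) : ∑ x : ZMod 239, f x.val = ∑ x ∈ Finset.range 239, f x :=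
  Fin.sum_univ_eq_sum_range f 239

theorem diff_card (M : ℕ) (c : ZMod 239) :
    ((maskSet M ×ˢ maskSet M).filter (fun p => p.1 - p.2 = c)).card = cnt M c.val 239 := by
  have h1 : ((maskSet M ×ˢ maskSet M).filter (fun p => p.1 - p.2 = c)).card
      = (Finset.univ.filter
          (fun b : ZMod 239 => bitAt M b.val = 1 ∧ bitAt M (b + c).val = 1)).card := by
    refine Finset.card_bij' (fun p _ => p.2) (fun b _ => (b + c, b)) ?_ ?_ ?_ ?_
    · rintro ⟨a, b⟩ h
      simp only [maskSet, Finset.mem_filter, Finset.mem_product, Finset.mem_univ, true_and] at h ⊢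
      obtain ⟨⟨ha, hb⟩, rfl⟩ := h
      exact ⟨hb, by simpa using ha⟩
    · intro b h
      simp only [maskSet, Finset.mem_filter, Finset.mem_product, Finset.mem_univ, true_and] at h ⊢
      exact ⟨⟨h.2, h.1⟩, by simp⟩
    · rintro ⟨a, b⟩ h
      simp only [Finset.mem_filter] at h
      simp [← h.2]
    · intro b h
      rfl
  rw [h1, cnt_eq, ← sum_zmod (fun x => bitAt M x * bitAt M ((x + c.val) % 239)),
    Finset.card_filter]
  refine Finset.sum_congr rfl fun b _ => ?_
  rw [← ZMod.val_add, bitAt_ite M b.val, bitAt_ite M (b + c).val]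
  split_ifs <;> simp_all

theorem mask_card (M : ℕ) : (maskSet M).card = cnt M 0 239 := by
  rw [cnt_eq, ← sum_zmod (fun x => bitAt M x * bitAt M ((x + 0) % 239)), maskSet,
    Finset.card_filter]
  refine Finset.sum_congr rfl fun b _ => ?_
  rw [Nat.add_zero, Nat.mod_eq_of_lt (ZMod.val_lt b), bitAt_ite M b.val]
  split_ifs <;> simp_all

theorem cnt_all : ∀ c : Fin 239, c.val ≠ 0 →
    cnt maskA c.val 239 + cnt maskB c.val 239 + cnt maskC c.val 239 = 158 := by
  decide +kernel

/-- The unions of orbits of the order-7 subgroup `H = {1,10,24,44,98,100,201}` of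
`(ZMod 239)ˣ` over the listed representative sets form an SDS with parameters
`(239; 119, 112, 106; 158)`. -/
theorem sds_239_first :
    let H : Finset (ZMod 239) := {1, 10, 24, 44, 98, 100, 201}
    let J : Finset (ZMod 239) := {1, 3, 5, 6, 15, 17, 19, 28, 34, 38, 39, 57, 58, 63, 85, 95, 107}
    let K : Finset (ZMod 239) := {1, 3, 4, 5, 15, 16, 17, 18, 19, 21, 23, 29, 35, 45, 58, 63}
    let L : Finset (ZMod 239) := {0, 1, 4, 6, 7, 8, 13, 16, 18, 34, 35, 45, 47, 58, 63, 95}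
    IsSDS 239 3
      ![J.biUnion (fun j => H.image (fun h => h * j)),
        K.biUnion (fun k => H.image (fun h => h * k)),
        L.biUnion (fun l => H.image (fun h => h * l))]
      ![119, 112, 106] 158 := by
  intro H J K L
  have hA : J.biUnion (fun j => H.image (fun h => h * j)) = maskSet maskA := by
    decide +kernel
  have hB : K.biUnion (fun j => H.image (fun h => h * j)) = maskSet maskB := by
    decide +kernel
  have hC : L.biUnion (fun j => H.image (fun h => h * j)) = maskSet maskC := by
    decide +kernel
  rw [hA, hB, hC]
  refine ⟨?_, ?_⟩
  · intro i
    fin_cases i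
    · exact (mask_card maskA).trans (by decide +kernel)
    · exact (mask_card maskB).trans (by decide +kernel)
    · exact (mask_card maskC).trans (by decide +kernel)
  · intro c hc
    have h := cnt_all ⟨c.val, ZMod.val_lt c⟩ (by simpa [ZMod.val_eq_zero] using hc)
    rw [Fin.sum_univ_three]
    have hs := congrArg₂ (· + ·) (congrArg₂ (· + ·) (diff_card maskA c) (diff_card maskB c))
      (diff_card maskC c)
    exact_mod_cast hs.trans h
end

section
/- Let H = {1, 10, 24, 44, 98, 100, 201} ⊆ Z_239, a subgroup of order 7 of Z_239^*, and set X1 = ⋃_{j ∈ J} H·j, X2 = ⋃_{k ∈ K} H·k, X3 = ⋃_{l ∈ L} H·l, where J = {1,3,9,13,14,15,16,18,23,28,29,38,42,45,58,85,107}, K = {4,6,7,8,9,13,14,17,28,39,45,47,57,58,95,107}, L = {0,1,4,5,6,9,13,18,21,34,35,39,42,57,85,95}. Then (X1, X2, X3) is a supplementary difference set in Z_239 with parameters (239; 119, 112, 106; 158). -/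
namespace SDSAux

/-- Number of `b < n` with `p b`. -/
def cnt (p : ℕ → Bool) : ℕ → ℕ
  | 0 => 0
  | n + 1 => cnt p n + (p n).toNat

theorem cnt_eq (p : ℕ → Bool) (n : ℕ) : cnt p n = ∑ b ∈ Finset.range n, (p b).toNat := by
  induction n with
  | zero => rfl
  | succ n ih => rw [cnt, ih, Finset.sum_range_succ]

theorem card_filter_eq (p : ℕ → Bool) :
    (Finset.univ.filter (fun b : ZMod 239 => p b.val = true)).card = cnt p 239 := by
  rw [cnt_eq, Finset.card_filter, ← Fin.sum_univ_eq_sum_range (fun b => (p b).toNat) 239]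
  change ∑ b : Fin 239, (if p b.val = true then 1 else 0) = _
  refine Finset.sum_congr rfl fun b _ => ?_
  cases p b.val <;> rfl

/-- Autocorrelation of the set with bit mask `m` at shift `c`. -/
def corr (m c : ℕ) : ℕ := cnt (fun b => m.testBit b && m.testBit ((b + c) % 239)) 239

theorem card_eq (X : Finset (ZMod 239)) (m : ℕ) (h : ∀ x : ZMod 239, x ∈ X ↔ m.testBit x.val = true) :
    X.card = cnt (fun b => m.testBit b) 239 := by
  rw [← card_filter_eq]
  congr 1
  ext x
  simp [h]

theorem corr_eq (X : Finset (ZMod 239)) (m : ℕ) (h : ∀ x : ZMod 239, x ∈ X ↔ m.testBit x.val = true)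
    (c : ZMod 239) :
    ((X ×ˢ X).filter (fun p => p.1 - p.2 = c)).card = corr m c.val := by
  rw [corr, ← card_filter_eq]
  refine Finset.card_bij' (fun p _ => p.2) (fun b _ => (b + c, b)) ?_ ?_ ?_ ?_
  · rintro ⟨a, b⟩ hp
    simp only [Finset.mem_filter, Finset.mem_product] at hp
    obtain ⟨⟨ha, hb⟩, rfl⟩ := hp
    have e : b + (a - b) = a := by ring
    simp only [Finset.mem_filter, Finset.mem_univ, true_and, Bool.and_eq_true, ← ZMod.val_add, e]
    exact ⟨(h b).1 hb, (h a).1 ha⟩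
  · intro b hb
    simp only [Finset.mem_filter, Finset.mem_univ, true_and, Bool.and_eq_true, ← ZMod.val_add] at hb
    simp only [Finset.mem_filter, Finset.mem_product]
    exact ⟨⟨(h _).2 hb.2, (h _).2 hb.1⟩, by ring⟩
  · rintro ⟨a, b⟩ hp
    simp only [Finset.mem_filter, Finset.mem_product] at hp
    obtain ⟨_, rfl⟩ := hp
    simp
  · intro b _
    rfl

/-- Bit mask of the union of orbits over `J`. -/
def mJ : ℕ := 554849778966161298224480099173736998172162969452039904220926488458159626

/-- Bit mask of the union of orbits over `K`. -/
def mK : ℕ := 355919461230252436298269000820129624730568495634056965001516340771711952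

/-- Bit mask of the union of orbits over `L`. -/
def mL : ℕ := 235187755779242356307422421843163834191755586241558768501304993163525747

/-- Fast kernel-friendly count: number of `b < n` with bit `b` set in `m` and bit `b + c` set in `w`. -/
def fast (m w c : ℕ) (n : ℕ) : ℕ :=
  Nat.rec 0 (fun b r => Nat.add (Nat.land (Nat.land (Nat.shiftRight m b)
    (Nat.shiftRight w (Nat.add b c))) 1) r) n

theorem land_one (m w b d : ℕ) :
    Nat.land (Nat.land (Nat.shiftRight m b) (Nat.shiftRight w d)) 1 =
      (m.testBit b && w.testBit d).toNat := by
  change ((m >>> b) &&& (w >>> d)) &&& 1 = _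
  have h : (m.testBit b && w.testBit d) = ((m >>> b) &&& (w >>> d)).testBit 0 := by
    simp
  rw [h, Nat.and_one_is_mod, Nat.testBit_zero]
  rcases Nat.mod_two_eq_zero_or_one ((m >>> b) &&& (w >>> d)) with e | e <;> simp [e]

theorem fast_eq (m w c n : ℕ) :
    fast m w c n = cnt (fun b => m.testBit b && w.testBit (b + c)) n := by
  induction n with
  | zero => rfl
  | succ n ih =>
    rw [cnt, ← ih, ← land_one]
    exact Nat.add_comm _ _

theorem corr_fast (m w c : ℕ) (hc : c < 239)
    (h : ∀ d < 478, w.testBit d = m.testBit (d % 239)) : fast m w c 239 = corr m c := by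
  rw [fast_eq, corr, cnt_eq, cnt_eq]
  refine Finset.sum_congr rfl fun b hb => ?_
  rw [Finset.mem_range] at hb
  rw [h (b + c) (by omega)]

/-- The mask `mJ` repeated twice. -/
def wJ : ℕ := 490167351679648709169183670667249759322851980852631215123627860767526508492849704749399011146356641395823081142151543848862809788193529024341514

theorem wJ_spec : ∀ d < 478, wJ.testBit d = mJ.testBit (d % 239) := by decide +kernel

/-- The mask `mK` repeated twice. -/
def wK : ℕ := 314427627686087738133901050855637653986245091754628730547329261667449348771718863468710841165746663004263178047440203532576398024502526037093328

theorem wK_spec : ∀ d < 478, wK.testBit d = mK.testBit (d % 239) := by decide +kernel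

/-- The mask `mL` repeated twice. -/
def wL : ℕ := 207770397985184926497318525617731682625586202399313339265190596456703888751717114158739484755210608232886707104930397584032111834079784392212083

theorem wL_spec : ∀ d < 478, wL.testBit d = mL.testBit (d % 239) := by decide +kernel

/-- All shifts `1 ≤ c ≤ n` have total autocorrelation 158. -/
def chk : ℕ → Bool
  | 0 => true
  | n + 1 => chk n && Nat.beq (Nat.add (Nat.add (fast mJ wJ (Nat.succ n) 239)
      (fast mK wK (Nat.succ n) 239)) (fast mL wL (Nat.succ n) 239)) 158

theorem chk_spec (n : ℕ) (h : chk n = true) (c : ℕ) (h0 : c ≠ 0) (hc : c ≤ n) (hn : n < 239) :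
    corr mJ c + corr mK c + corr mL c = 158 := by
  induction n with
  | zero => omega
  | succ n ih =>
    rw [chk, Bool.and_eq_true] at h
    rcases Nat.lt_or_ge n c with hlt | hge
    · obtain rfl : c = n + 1 := by omega
      rw [← corr_fast mJ wJ _ hn wJ_spec, ← corr_fast mK wK _ hn wK_spec,
        ← corr_fast mL wL _ hn wL_spec]
      exact Nat.eq_of_beq_eq_true h.2
    · exact ih h.1 hge (by omega)

theorem chk_all : chk 238 = true := by decide +kernel

theorem memJ : ∀ x : ZMod 239,
    x ∈ ({1, 3, 9, 13, 14, 15, 16, 18, 23, 28, 29, 38, 42, 45, 58, 85, 107} : Finset (ZMod 239)).biUnion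
      (fun j => ({1, 10, 24, 44, 98, 100, 201} : Finset (ZMod 239)).image (fun h => h * j)) ↔
    mJ.testBit x.val = true := by
  decide +kernel

theorem memK : ∀ x : ZMod 239,
    x ∈ ({4, 6, 7, 8, 9, 13, 14, 17, 28, 39, 45, 47, 57, 58, 95, 107} : Finset (ZMod 239)).biUnion
      (fun j => ({1, 10, 24, 44, 98, 100, 201} : Finset (ZMod 239)).image (fun h => h * j)) ↔
    mK.testBit x.val = true := by
  decide +kernel

theorem memL : ∀ x : ZMod 239,
    x ∈ ({0, 1, 4, 5, 6, 9, 13, 18, 21, 34, 35, 39, 42, 57, 85, 95} : Finset (ZMod 239)).biUnion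
      (fun j => ({1, 10, 24, 44, 98, 100, 201} : Finset (ZMod 239)).image (fun h => h * j)) ↔
    mL.testBit x.val = true := by
  decide +kernel

end SDSAux

/-- The unions of orbits of the order-7 subgroup `H = {1,10,24,44,98,100,201}` of
`(ZMod 239)ˣ` over the listed representative sets form an SDS with parameters
`(239; 119, 112, 106; 158)`. -/
theorem sds_239_second :
    let H : Finset (ZMod 239) := {1, 10, 24, 44, 98, 100, 201}
    let J : Finset (ZMod 239) := {1, 3, 9, 13, 14, 15, 16, 18, 23, 28, 29, 38, 42, 45, 58, 85, 107}
    let K : Finset (ZMod 239) := {4, 6, 7, 8, 9, 13, 14, 17, 28, 39, 45, 47, 57, 58, 95, 107}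
    let L : Finset (ZMod 239) := {0, 1, 4, 5, 6, 9, 13, 18, 21, 34, 35, 39, 42, 57, 85, 95}
    IsSDS 239 3
      ![J.biUnion (fun j => H.image (fun h => h * j)),
        K.biUnion (fun k => H.image (fun h => h * k)),
        L.biUnion (fun l => H.image (fun h => h * l))]
      ![119, 112, 106] 158 := by
  intro H J K L
  refine ⟨?_, ?_⟩
  · intro i
    fin_cases i
    · exact (SDSAux.card_eq _ _ SDSAux.memJ).trans (by decide +kernel)
    · exact (SDSAux.card_eq _ _ SDSAux.memK).trans (by decide +kernel)
    · exact (SDSAux.card_eq _ _ SDSAux.memL).trans (by decide +kernel)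
  · intro c hc
    have hJ := SDSAux.corr_eq _ _ SDSAux.memJ c
    have hK := SDSAux.corr_eq _ _ SDSAux.memK c
    have hL := SDSAux.corr_eq _ _ SDSAux.memL c
    have hlt := ZMod.val_lt c
    have key := SDSAux.chk_spec 238 SDSAux.chk_all c.val
      (fun h => hc ((ZMod.val_eq_zero c).1 h)) (by omega) (by omega)
    rw [← hJ, ← hK, ← hL] at key
    rw [Fin.sum_univ_three]
    exact congrArg Nat.cast key
end

section
/- Let H = {1, 74, 80, 85, 111, 120, 167, 180, 270, 274, 293} ⊆ Z_331, a subgroup of order 11 of Z_331^*, and set X0 = ⋃_{m ∈ M} H·m, X1 = ⋃_{j ∈ J′} H·j, X2 = ⋃_{k ∈ K} H·k, X3 = ⋃_{l ∈ L} H·l, where M = {2,4,8,10,14,16,20,28,38,31,32,37,56,62,64}, J′ = {0,7,8,13,14,19,28,31,37,38,49,53,62,73,76}, K = {0,1,5,7,8,10,11,16,31,38,41,56,62,64,73}, L = {0,1,7,8,10,13,14,19,22,32,37,44,62,73,76}. Then (X0, X1, X2, X3) is a supplementary difference set in Z_331 with parameters (331; 165, 155, 155, 155; 299), and X0 is of skew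 type. -/
/-- The four blocks encoded as bit masks. -/
def mask : Fin 4 → ℕ :=
  ![2360809645426596497219939816741312078655699686989238269737739843343787701550189428762126471201806172,
    3969341409053500792150169895251229371587257178578904294019719014628635516832810232801322403074175361,
    2708971364392831395480516173140001371784336640459045599113903549857578994448858342626294079829810595,
    1795423671480507947550743821688950988158415456611398148634848530763673798723243798350390818484581763]

/-- Membership in the block with index `i`, read off the mask. -/
def inB (i : Fin 4) (x : ZMod 331) : Bool := (mask i).testBit x.val

/-- Number of `x` with `x` and `x + c` both in block `i`. -/
def corr (i : Fin 4) (c : ZMod 331) : ℕ :=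
  (Finset.univ.filter (fun x : ZMod 331 => inB i x = true ∧ inB i (x + c) = true)).card

/-- The same number by a loop on natural numbers. -/
def loop (N c : ℕ) : ℕ → ℕ
  | 0 => 0
  | n + 1 => Nat.add (loop N c n) (Nat.mul (Nat.mod (Nat.div N (Nat.pow 2 n)) 2)
      (Nat.mod (Nat.div N (Nat.pow 2 (Nat.mod (Nat.add n c) 331))) 2))

theorem loop_eq (N c n : ℕ) : loop N c n =
    ∑ j ∈ Finset.range n, ((N.testBit j) && (N.testBit ((j + c) % 331))).toNat := by
  induction n with
  | zero => rfl
  | succ n ih =>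
    have h : loop N c (n + 1) = loop N c n + (N / 2 ^ n % 2) * (N / 2 ^ ((n + c) % 331) % 2) := rfl
    rw [Finset.sum_range_succ, h, ih, ← Nat.toNat_testBit, ← Nat.toNat_testBit]
    cases N.testBit n <;> cases N.testBit ((n + c) % 331) <;> rfl

theorem corr_eq (i : Fin 4) (c : ZMod 331) : corr i c = loop (mask i) c.val 331 := by
  rw [loop_eq, corr, Finset.card_filter, ← Fin.sum_univ_eq_sum_range
    (fun j => (((mask i).testBit j) && ((mask i).testBit ((j + c.val) % 331))).toNat)]
  refine Finset.sum_congr rfl (fun x _ => ?_)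
  have h : (x + c).val = (x.val + c.val) % 331 := ZMod.val_add x c
  have h2 : ZMod.val x = Fin.val (n := 331) x := rfl
  simp only [inB, h]
  rw [h2]
  cases (mask i).testBit (Fin.val (n := 331) x) <;>
    cases (mask i).testBit ((Fin.val (n := 331) x + c.val) % 331) <;> rfl

theorem inB_mul : ∀ i : Fin 4, ∀ x : ZMod 331, inB i (74 * x) = inB i x := by
  decide +kernel

theorem corr_mul (i : Fin 4) (c : ZMod 331) : corr i (74 * c) = corr i c := by
  symm
  have h1 : (85 : ZMod 331) * 74 = 1 := by decide +kernel
  have h2 : (74 : ZMod 331) * 85 = 1 := by decide +kernel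
  refine Finset.card_bij' (fun x _ => 74 * x) (fun x _ => 85 * x) ?_ ?_ ?_ ?_
  · intro x hx
    simpa [← mul_add, inB_mul] using hx
  · intro x hx
    have e1 := inB_mul i (85 * x)
    have e2 := inB_mul i (85 * x + c)
    rw [mul_add, ← mul_assoc, h2, one_mul] at e2
    rw [← mul_assoc, h2, one_mul] at e1
    simpa [e1, e2] using hx
  · intro x _
    simp only [← mul_assoc, h1, one_mul]
  · intro x _
    simp only [← mul_assoc, h2, one_mul]

theorem corr_pow (i : Fin 4) (k : ℕ) (c : ZMod 331) : corr i (74 ^ k * c) = corr i c := by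
  induction k with
  | zero => simp
  | succ k ih => rw [pow_succ', mul_assoc, corr_mul, ih]

/-- The bit mask of a list. -/
def toMask (l : List ℕ) : ℕ := l.foldr (fun a N => Nat.lor (Nat.shiftLeft 1 a) N) 0

theorem testBit_toMask (l : List ℕ) (j : ℕ) : (toMask l).testBit j = true ↔ j ∈ l := by
  induction l with
  | nil => simp [toMask]
  | cons a l ih =>
    have h : toMask (a :: l) = 2 ^ a ||| toMask l := by
      rw [← Nat.one_shiftLeft]
      rfl
    rw [h, Nat.testBit_or, Bool.or_eq_true, ih, Nat.testBit_two_pow]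
    simp [eq_comm]

/-- The subgroup as a list of natural numbers. -/
def Hl : List ℕ := [1, 74, 80, 85, 111, 120, 167, 180, 270, 274, 293]

/-- Union of the orbits of the members of `S`. -/
def orb (S : List ℕ) : List ℕ := S.flatMap (fun m => Hl.map (fun h => Nat.mod (Nat.mul h m) 331))

theorem mem_orb (S : List ℕ) (x : ZMod 331) :
    x.val ∈ orb S ↔ ∃ m ∈ S, ∃ h ∈ Hl, (h : ZMod 331) * (m : ZMod 331) = x := by
  simp only [orb, List.mem_flatMap, List.mem_map]
  refine exists_congr (fun m => and_congr_right (fun _ => exists_congr (fun h =>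
    and_congr_right (fun _ => ?_))))
  have e : Nat.mod (Nat.mul h m) 331 = ((h * m : ℕ) : ZMod 331).val := (ZMod.val_natCast 331 _).symm
  rw [e, ← Nat.cast_mul]
  exact (ZMod.val_injective 331).eq_iff

theorem mem_block (i : Fin 4) (S : List ℕ) (hS : toMask (orb S) = mask i)
    (H M : Finset (ZMod 331)) (hH : H = (Hl.map (Nat.cast : ℕ → ZMod 331)).toFinset)
    (hM : M = (S.map (Nat.cast : ℕ → ZMod 331)).toFinset) (x : ZMod 331) :
    x ∈ M.biUnion (fun m => H.image (fun h => h * m)) ↔ inB i x = true := by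
  rw [inB, ← hS, testBit_toMask, mem_orb, hH, hM]
  simp

/-- Representatives of the nonzero orbits. -/
def reps : List ℕ := [1, 2, 4, 5, 7, 8, 10, 11, 13, 14, 16, 19, 20, 22, 28, 31, 32, 37, 38, 41, 44, 49, 53, 56, 62, 64, 73, 76, 88, 101]

theorem reps_mask : toMask (orb reps) = 2 ^ 331 - 2 ^ 1 := by
  decide +kernel

theorem Hl_pow : ∀ h ∈ Hl, ∃ k : Fin 11, (74 : ZMod 331) ^ k.val = (h : ZMod 331) := by
  decide +kernel

theorem cover (c : ZMod 331) (hc : c ≠ 0) :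
    ∃ r ∈ reps, ∃ k : Fin 11, 74 ^ k.val * (r : ZMod 331) = c := by
  have hv : c.val ∈ orb reps := by
    rw [← testBit_toMask, reps_mask]
    have h1 : c.val < 331 := ZMod.val_lt c
    have h2 : c.val ≠ 0 := fun h => hc ((ZMod.val_eq_zero c).1 h)
    generalize c.val = n at h1 h2
    revert n
    decide +kernel
  obtain ⟨r, hr, h, hh, e⟩ := (mem_orb reps c).1 hv
  obtain ⟨k, hk⟩ := Hl_pow h hh
  exact ⟨r, hr, k, by rw [hk, e]⟩

theorem reps_total : ∀ r ∈ reps, ∑ i : Fin 4, loop (mask i) r 331 = 299 := by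
  decide +kernel

theorem corr_total (c : ZMod 331) (hc : c ≠ 0) : ∑ i : Fin 4, corr i c = 299 := by
  obtain ⟨r, hr, k, rfl⟩ := cover c hc
  have hlt : ∀ r ∈ reps, r < 331 := by decide
  have hv : (r : ZMod 331).val = r := ZMod.val_cast_of_lt (hlt r hr)
  rw [← reps_total r hr]
  exact Finset.sum_congr rfl (fun i _ => by
    rw [corr_pow i k.val r, corr_eq i r, hv])

theorem card_diff (i : Fin 4) (X : Finset (ZMod 331)) (hX : ∀ x, x ∈ X ↔ inB i x = true)
    (c : ZMod 331) : ((X ×ˢ X).filter (fun p => p.1 - p.2 = c)).card = corr i c := by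
  refine Finset.card_bij' (fun p _ => p.2) (fun x _ => (x + c, x)) ?_ ?_ ?_ ?_
  · rintro ⟨a, b⟩ h
    simp only [Finset.mem_filter, Finset.mem_product, hX] at h
    obtain ⟨⟨ha, hb⟩, rfl⟩ := h
    simp [ha, hb]
  · intro x h
    simp only [Finset.mem_filter] at h
    simp [hX, h.2.1, h.2.2]
  · rintro ⟨a, b⟩ h
    simp only [Finset.mem_filter] at h
    obtain ⟨_, rfl⟩ := h
    simp
  · intro x _
    rfl

theorem card_mask : ∀ i : Fin 4, (Finset.univ.filter (fun x : ZMod 331 => inB i x = true)).card =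
    (![165, 155, 155, 155] : Fin 4 → ℕ) i := by
  decide +kernel

theorem skew_mask : inB 0 0 = false ∧ ∀ i : ZMod 331, i ≠ 0 → inB 0 i = !(inB 0 (-i)) := by
  decide +kernel

/-- The unions of orbits of the order-11 subgroup
`H = {1,74,80,85,111,120,167,180,270,274,293}` of `(ZMod 331)ˣ` over the listed
representative sets form an SDS with parameters `(331; 165, 155, 155, 155; 299)`
whose first block is of skew type. -/
theorem sds_331_second :
    let H : Finset (ZMod 331) := {1, 74, 80, 85, 111, 120, 167, 180, 270, 274, 293}
    let M : Finset (ZMod 331) := {2, 4, 8, 10, 14, 16, 20, 28, 38, 31, 32, 37, 56, 62, 64}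
    let J : Finset (ZMod 331) := {0, 7, 8, 13, 14, 19, 28, 31, 37, 38, 49, 53, 62, 73, 76}
    let K : Finset (ZMod 331) := {0, 1, 5, 7, 8, 10, 11, 16, 31, 38, 41, 56, 62, 64, 73}
    let L : Finset (ZMod 331) := {0, 1, 7, 8, 10, 13, 14, 19, 22, 32, 37, 44, 62, 73, 76}
    IsSDS 331 4
      ![M.biUnion (fun m => H.image (fun h => h * m)),
        J.biUnion (fun j => H.image (fun h => h * j)),
        K.biUnion (fun k => H.image (fun h => h * k)),
        L.biUnion (fun l => H.image (fun h => h * l))]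
      ![165, 155, 155, 155] 299 ∧
    IsSkewType 331 (M.biUnion (fun m => H.image (fun h => h * m))) := by
  intro H M J K L
  have h0 : ∀ x, x ∈ M.biUnion (fun m => H.image (fun h => h * m)) ↔ inB 0 x = true :=
    mem_block 0 [2, 4, 8, 10, 14, 16, 20, 28, 38, 31, 32, 37, 56, 62, 64]
      (by decide +kernel) H M (by decide +kernel) (by decide +kernel)
  have h1 : ∀ x, x ∈ J.biUnion (fun m => H.image (fun h => h * m)) ↔ inB 1 x = true :=
    mem_block 1 [0, 7, 8, 13, 14, 19, 28, 31, 37, 38, 49, 53, 62, 73, 76]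
      (by decide +kernel) H J (by decide +kernel) (by decide +kernel)
  have h2 : ∀ x, x ∈ K.biUnion (fun m => H.image (fun h => h * m)) ↔ inB 2 x = true :=
    mem_block 2 [0, 1, 5, 7, 8, 10, 11, 16, 31, 38, 41, 56, 62, 64, 73]
      (by decide +kernel) H K (by decide +kernel) (by decide +kernel)
  have h3 : ∀ x, x ∈ L.biUnion (fun m => H.image (fun h => h * m)) ↔ inB 3 x = true :=
    mem_block 3 [0, 1, 7, 8, 10, 13, 14, 19, 22, 32, 37, 44, 62, 73, 76]
      (by decide +kernel) H L (by decide +kernel) (by decide +kernel)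
  generalize M.biUnion (fun m => H.image (fun h => h * m)) = X0 at *
  generalize J.biUnion (fun m => H.image (fun h => h * m)) = X1 at *
  generalize K.biUnion (fun m => H.image (fun h => h * m)) = X2 at *
  generalize L.biUnion (fun m => H.image (fun h => h * m)) = X3 at *
  have hX : ∀ i : Fin 4, ∀ x, x ∈ (![X0, X1, X2, X3] : Fin 4 → Finset (ZMod 331)) i ↔
      inB i x = true := by
    intro i
    fin_cases i
    · exact h0
    · exact h1
    · exact h2
    · exact h3
  refine ⟨⟨fun i => ?_, fun c hc => ?_⟩, ?_, fun i hi => ?_⟩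
  · rw [← card_mask i]
    congr 1
    ext x
    simp [hX i x]
  · rw [Finset.sum_congr rfl (fun i _ => card_diff i _ (hX i) c), corr_total c hc]
    rfl
  · rw [h0, skew_mask.1]
    decide
  · rw [h0, h0, skew_mask.2 i hi]
    simp
end

section
/- Let H = {1, 23, 55} ⊆ Z_79, a subgroup of order 3 of Z_79^*, and set X1 = ⋃_{j ∈ J} H·j, X2 = ⋃_{k ∈ K} H·k, X3 = ⋃_{l ∈ L} H·l, where J = {0,2,5,6,9,18,20,22,27,30,33,34,40}, K = {0,1,6,15,18,22,24,30,33,34,41,47}, L = {1,2,3,4,5,10,11,20,27,33,41}. Then (X1, X2, X3) is a supplementary difference set in Z_79 with parameters (79; 37, 34, 33; 45). -/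
/-- Number of `x < n` such that both `x` and `x + c` (mod 79) are set bits of `m`. -/
def cnt79 (m c : ℕ) : ℕ → ℕ
  | 0 => 0
  | n + 1 => cnt79 m c n +
      (match m.testBit ((n + c) % 79) && m.testBit n with | true => 1 | false => 0)

theorem cnt79_eq (m c n : ℕ) : cnt79 m c n = ∑ x ∈ Finset.range n,
    (if m.testBit ((x + c) % 79) = true ∧ m.testBit x = true then 1 else 0) := by
  induction n with
  | zero => rfl
  | succ n ih =>
    rw [Finset.sum_range_succ, cnt79, ih]
    congr 1
    cases m.testBit ((n + c) % 79) <;> cases m.testBit n <;> rfl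

theorem card_diff79 (X : Finset (ZMod 79)) (m : ℕ)
    (h : ∀ x : ZMod 79, x ∈ X ↔ m.testBit x.val = true) (c : ZMod 79) :
    ((X ×ˢ X).filter (fun p => p.1 - p.2 = c)).card = cnt79 m c.val 79 := by
  have e : (X ×ˢ X).filter (fun p => p.1 - p.2 = c) =
      ((Finset.univ : Finset (ZMod 79)).filter (fun x => x + c ∈ X ∧ x ∈ X)).image
        (fun x => (x + c, x)) := by
    ext ⟨a, b⟩
    simp only [Finset.mem_filter, Finset.mem_product, Finset.mem_image, Finset.mem_univ,
      true_and, Prod.mk.injEq]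
    constructor
    · rintro ⟨⟨ha, hb⟩, hc⟩
      have : b + c = a := by rw [← hc]; ring
      exact ⟨b, ⟨by rwa [this], hb⟩, this, rfl⟩
    · rintro ⟨x, ⟨h1, h2⟩, rfl, rfl⟩
      exact ⟨⟨h1, h2⟩, by ring⟩
  rw [e, Finset.card_image_of_injective _ (fun x y hxy => (Prod.mk.inj hxy).2),
    Finset.card_filter, cnt79_eq, ← Fin.sum_univ_eq_sum_range]
  refine Finset.sum_congr rfl fun x _ => ?_
  simp only [h, ZMod.val_add]
  rfl

theorem card79 (X : Finset (ZMod 79)) (m : ℕ)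
    (h : ∀ x : ZMod 79, x ∈ X ↔ m.testBit x.val = true) :
    X.card = cnt79 m 0 79 := by
  rw [← ZMod.val_zero (n := 79), ← card_diff79 X m h 0]
  symm
  refine Finset.card_bij (fun p _ => p.1) ?_ ?_ ?_
  · intro p hp
    simp only [Finset.mem_filter, Finset.mem_product] at hp
    exact hp.1.1
  · rintro ⟨a, b⟩ hp ⟨a', b'⟩ hq hh
    simp only [Finset.mem_filter, sub_eq_zero] at hp hq hh
    rw [Prod.mk.injEq]
    exact ⟨hh, by rw [← hp.2, ← hq.2, hh]⟩
  · intro b hb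
    exact ⟨(b, b), by simp [hb], rfl⟩

theorem cnt79_all : ∀ c < 79, c ≠ 0 →
    cnt79 164591950868469289599589 c 79 + cnt79 475779567501093834113091 c 79 +
      cnt79 260666369715161208532158 c 79 = 45 := by
  decide +kernel

/-- The unions of orbits of the order-3 subgroup `H = {1, 23, 55}` of `(ZMod 79)ˣ` over the
listed representative sets form an SDS with parameters `(79; 37, 34, 33; 45)`. -/
theorem sds_79 :
    let H : Finset (ZMod 79) := {1, 23, 55}
    let J : Finset (ZMod 79) := {0, 2, 5, 6, 9, 18, 20, 22, 27, 30, 33, 34, 40}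
    let K : Finset (ZMod 79) := {0, 1, 6, 15, 18, 22, 24, 30, 33, 34, 41, 47}
    let L : Finset (ZMod 79) := {1, 2, 3, 4, 5, 10, 11, 20, 27, 33, 41}
    IsSDS 79 3
      ![J.biUnion (fun j => H.image (fun h => h * j)),
        K.biUnion (fun k => H.image (fun h => h * k)),
        L.biUnion (fun l => H.image (fun h => h * l))]
      ![37, 34, 33] 45 := by
  intro H J K L
  have h1 : ∀ x : ZMod 79, x ∈ J.biUnion (fun j => H.image (fun h => h * j)) ↔
      Nat.testBit 164591950868469289599589 x.val = true := by decide +kernel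
  have h2 : ∀ x : ZMod 79, x ∈ K.biUnion (fun j => H.image (fun h => h * j)) ↔
      Nat.testBit 475779567501093834113091 x.val = true := by decide +kernel
  have h3 : ∀ x : ZMod 79, x ∈ L.biUnion (fun j => H.image (fun h => h * j)) ↔
      Nat.testBit 260666369715161208532158 x.val = true := by decide +kernel
  refine ⟨?_, ?_⟩
  · intro i
    fin_cases i
    · exact (card79 _ _ h1).trans (by decide +kernel)
    · exact (card79 _ _ h2).trans (by decide +kernel)
    · exact (card79 _ _ h3).trans (by decide +kernel)
  · intro c hc
    have key := cnt79_all c.val (ZMod.val_lt c) (fun h => hc ((ZMod.val_eq_zero c).1 h))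
    rw [← card_diff79 _ _ h1 c, ← card_diff79 _ _ h2 c, ← card_diff79 _ _ h3 c] at key
    rw [Fin.sum_univ_three]
    exact congrArg (fun n : ℕ => (n : ℤ)) key
end

section
/- Let H = {1, 53, 58, 61, 89} ⊆ Z_131, a subgroup of order 5 of Z_131^*, and set X1 = ⋃_{j ∈ J} H·j, X2 = ⋃_{k ∈ K} H·k, X3 = ⋃_{l ∈ L} H·l, where J = {2,3,4,7,8,9,11,18,19,33,36,38,51}, K = {0,1,2,6,7,8,9,14,22,27,36,42,44}, L = {1,2,14,17,21,22,29,38,42,51,79}. Then (X1, X2, X3) is a supplementary difference set in Z_131 with parameters (131; 65, 61, 55; 83). -/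
/-- The `n`-th binary digit of `M`. -/
def sdsBit (M n : ℕ) : ℕ := (M >>> n) % 2

/-- Number of `b < n` with both `b` and `b + c` (mod 131) in the set coded by `M`. -/
def sdsCnt (M c : ℕ) : ℕ → ℕ
  | 0 => 0
  | n + 1 => sdsCnt M c n + sdsBit M n * sdsBit M ((n + c) % 131)

lemma sdsCnt_eq (M c n : ℕ) :
    sdsCnt M c n = ∑ i ∈ Finset.range n, sdsBit M i * sdsBit M ((i + c) % 131) := by
  induction n with
  | zero => rfl
  | succ n ih => rw [Finset.sum_range_succ, ← ih, sdsCnt]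

lemma sdsBit_eq (M n : ℕ) : sdsBit M n = if sdsBit M n = 1 then 1 else 0 := by
  have : sdsBit M n < 2 := Nat.mod_lt _ (by norm_num)
  split_ifs <;> omega

lemma sds_card_filter (X : Finset (ZMod 131)) (M : ℕ)
    (h : ∀ a : ZMod 131, a ∈ X ↔ sdsBit M a.val = 1) (c : ZMod 131) :
    ((X ×ˢ X).filter (fun p => p.1 - p.2 = c)).card = sdsCnt M c.val 131 := by
  have h1 : ((X ×ˢ X).filter (fun p => p.1 - p.2 = c)).card
      = (Finset.univ.filter (fun b : ZMod 131 => b ∈ X ∧ b + c ∈ X)).card := by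
    symm
    apply Finset.card_bij (fun b _ => (b + c, b))
    · intro b hb
      simp only [Finset.mem_filter, Finset.mem_univ, true_and, Finset.mem_product] at hb ⊢
      exact ⟨⟨hb.2, hb.1⟩, by ring⟩
    · intro a _ b _ hab
      exact (Prod.ext_iff.mp hab).2
    · rintro ⟨a, b⟩ hab
      simp only [Finset.mem_filter, Finset.mem_product] at hab
      obtain ⟨⟨ha, hb⟩, rfl⟩ := hab
      refine ⟨b, ?_, ?_⟩
      · simp [ha, hb]
      · simp
  rw [h1, sdsCnt_eq, Finset.card_filter,
    ← Fin.sum_univ_eq_sum_range (fun i => sdsBit M i * sdsBit M ((i + c.val) % 131)) 131]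
  refine Finset.sum_congr rfl fun b _ => ?_
  change ZMod 131 at b
  change _ = sdsBit M b.val * sdsBit M ((b.val + c.val) % 131)
  rw [← ZMod.val_add, sdsBit_eq M b.val, sdsBit_eq M (b + c).val]
  simp only [h]
  by_cases h1 : sdsBit M b.val = 1 <;> by_cases h2 : sdsBit M (b + c).val = 1 <;> simp [h1, h2]

lemma sds_card (X : Finset (ZMod 131)) (M : ℕ)
    (h : ∀ a : ZMod 131, a ∈ X ↔ sdsBit M a.val = 1) :
    X.card = sdsCnt M 0 131 := by
  rw [← ZMod.val_zero (n := 131), ← sds_card_filter X M h 0]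
  symm
  apply Finset.card_bij (fun p _ => p.1)
  · intro p hp
    simp only [Finset.mem_filter, Finset.mem_product] at hp
    exact hp.1.1
  · rintro ⟨a, b⟩ hp ⟨a', b'⟩ hq hab
    simp only [Finset.mem_filter, Finset.mem_product, sub_eq_zero] at hp hq hab
    rw [Prod.mk.injEq]
    exact ⟨hab, by rw [← hp.2, ← hq.2, hab]⟩
  · intro a ha
    exact ⟨(a, a), by simp [ha], rfl⟩

lemma sds_count : ∀ c : Fin 131, c.val ≠ 0 →
    sdsCnt 867439315690446976089434464212812147644 c.val 131 + sdsCnt 2124688667626843113588677983834535421895 c.val 131 + sdsCnt 1814855018126609301186384759895290429446 c.val 131 = 83 := by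
  decide +kernel



/-- The unions of orbits of the order-5 subgroup `H = {1, 53, 58, 61, 89}` of `(ZMod 131)ˣ` over the
listed representative sets form an SDS with parameters `(131; 65, 61, 55; 83)`. -/
theorem sds_131 :
    let H : Finset (ZMod 131) := {1, 53, 58, 61, 89}
    let J : Finset (ZMod 131) := {2, 3, 4, 7, 8, 9, 11, 18, 19, 33, 36, 38, 51}
    let K : Finset (ZMod 131) := {0, 1, 2, 6, 7, 8, 9, 14, 22, 27, 36, 42, 44}
    let L : Finset (ZMod 131) := {1, 2, 14, 17, 21, 22, 29, 38, 42, 51, 79}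
    IsSDS 131 3
      ![J.biUnion (fun j => H.image (fun h => h * j)),
        K.biUnion (fun k => H.image (fun h => h * k)),
        L.biUnion (fun l => H.image (fun h => h * l))]
      ![65, 61, 55] 83 := by
  intro H J K L
  have hJ : ∀ a : ZMod 131, a ∈ J.biUnion (fun j => H.image (fun h => h * j)) ↔
      sdsBit 867439315690446976089434464212812147644 a.val = 1 := by
    decide +kernel
  have hK : ∀ a : ZMod 131, a ∈ K.biUnion (fun j => H.image (fun h => h * j)) ↔
      sdsBit 2124688667626843113588677983834535421895 a.val = 1 := by
    decide +kernel
  have hL : ∀ a : ZMod 131, a ∈ L.biUnion (fun j => H.image (fun h => h * j)) ↔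
      sdsBit 1814855018126609301186384759895290429446 a.val = 1 := by
    decide +kernel
  refine ⟨?_, ?_⟩
  · intro i
    fin_cases i
    · exact (sds_card _ _ hJ).trans (by decide +kernel)
    · exact (sds_card _ _ hK).trans (by decide +kernel)
    · exact (sds_card _ _ hL).trans (by decide +kernel)
  · intro c hc
    rw [Fin.sum_univ_three]
    have e := sds_count c (fun h0 => hc ((ZMod.val_eq_zero c).mp h0))
    have e1 := sds_card_filter _ _ hJ c
    have e2 := sds_card_filter _ _ hK c
    have e3 := sds_card_filter _ _ hL c
    have e4 := (congrArg₂ (· + ·) (congrArg₂ (· + ·) e1 e2) e3).trans e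
    exact congrArg (Nat.cast : ℕ → ℤ) e4
end
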